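/- Consider ReLU networks with base-2 quantized weights, R_b^a(d,W,L) = R_{Q_b^a}(d,W,L) with Q_b^a = (−2^{a+1}, 2^{a+1}) ∩ 2^{−b}ℤ. (i) There exists an absolute constant C ∈ ℝ_+ such that for every p ∈ [1,∞], all d, W, L, a, b ∈ ℕ with W ≥ d, and every ε ∈ (0,1/2), log N(ε, R_b^a(d,W,L), L^p([0,1]^d)) ≤ C · W²L · min{ a+b, log((W+1)^L 2^{aL} / ε) }. (ii) There exist absolute constants c, D, E ∈ ℝ_+ such that for W, L ≥ D with L(a+b) ≥ E·log(W), and every ε ∈ (0, 1/100), log N(ε, R_b^a(d,W,L), L^p([0,1]^d)) ≥ c · W²L · min{ a+b, log((W+1)^L 2^{aL} / ε) }. -/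

import Mathlib

open MeasureTheory ProbabilityTheory ENNReal

noncomputable section

/-- A ReLU network configuration with input dimension `d`:
a finite sequence of matrix–vector pairs `(A_i, b_i)`, `i = 0, …, depth − 1`. -/
structure ReLUNet (d : ℕ) where
  depth : ℕ
  depth_pos : 0 < depth
  width : ℕ → ℕ
  width_in : width 0 = d
  width_out : width depth = 1
  A : ∀ i : ℕ, Matrix (Fin (width (i + 1))) (Fin (width i)) ℝ
  b : ∀ i : ℕ, Fin (width (i + 1)) → ℝ

namespace ReLUNet

variable {d : ℕ}

/-- The affine map `x ↦ A_i x + b_i` of layer `i`. -/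
def layer (Φ : ReLUNet d) (i : ℕ) (x : Fin (Φ.width i) → ℝ) :
    Fin (Φ.width (i + 1)) → ℝ :=
  fun j => (∑ k, Φ.A i j k * x k) + Φ.b i j

/-- Output after the first `i` affine layers, with the ReLU activation `ρ(x) = max{x,0}`
applied between consecutive affine layers (not on the input and not after the last
affine layer). -/
def forward (Φ : ReLUNet d) : (i : ℕ) → (Fin (Φ.width 0) → ℝ) → Fin (Φ.width i) → ℝ
  | 0, x => x
  | i + 1, x =>
      Φ.layer i fun k => if i = 0 then Φ.forward i x k else max (Φ.forward i x k) 0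

/-- The realization `R(Φ) : ℝ^d → ℝ` of a network configuration. -/
def realization (Φ : ReLUNet d) (x : Fin d → ℝ) : ℝ :=
  Φ.forward Φ.depth (fun k => x (Fin.cast Φ.width_in k)) (Fin.cast Φ.width_out.symm 0)

/-- All layer widths are at most `W`. -/
def widthLe (Φ : ReLUNet d) (W : ℕ) : Prop :=
  ∀ i ≤ Φ.depth, Φ.width i ≤ W

/-- All weights have absolute value at most `B`. -/
def magLe (Φ : ReLUNet d) (B : ℝ) : Prop :=
  ∀ i < Φ.depth, (∀ j k, |Φ.A i j k| ≤ B) ∧ ∀ j, |Φ.b i j| ≤ B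

/-- All weights take values in the set `𝔸`. -/
def coefIn (Φ : ReLUNet d) (𝔸 : Set ℝ) : Prop :=
  ∀ i < Φ.depth, (∀ j k, Φ.A i j k ∈ 𝔸) ∧ ∀ j, Φ.b i j ∈ 𝔸

open Classical in
/-- The connectivity (total number of nonzero weights) of a network configuration. -/
def connectivity (Φ : ReLUNet d) : ℕ :=
  ∑ i ∈ Finset.range Φ.depth,
    ((Finset.univ.filter fun jk : Fin (Φ.width (i + 1)) × Fin (Φ.width i) =>
        Φ.A i jk.1 jk.2 ≠ 0).card
      + (Finset.univ.filter fun j : Fin (Φ.width (i + 1)) => Φ.b i j ≠ 0).card)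

end ReLUNet

/-- `R(d,W,L,B)`: realizations of ReLU networks with input dimension `d`, output
dimension 1, width at most `W`, depth at most `L`, and weight magnitude at most `B`. -/
def RclassB (d W L : ℕ) (B : ℝ) : Set ((Fin d → ℝ) → ℝ) :=
  {f | ∃ Φ : ReLUNet d, Φ.widthLe W ∧ Φ.depth ≤ L ∧ Φ.magLe B ∧ Φ.realization = f}

/-- `R(d,W,L)`: realizations with width at most `W` and depth at most `L`,
with no constraint on the weight magnitude. -/
def Rclass (d W L : ℕ) : Set ((Fin d → ℝ) → ℝ) :=
  {f | ∃ Φ : ReLUNet d, Φ.widthLe W ∧ Φ.depth ≤ L ∧ Φ.realization = f}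

/-- `R_𝔸(d,W,L)`: realizations with width at most `W`, depth at most `L`, and all
weights taking values in `𝔸`. -/
def RclassCoef (d W L : ℕ) (𝔸 : Set ℝ) : Set ((Fin d → ℝ) → ℝ) :=
  {f | ∃ Φ : ReLUNet d, Φ.widthLe W ∧ Φ.depth ≤ L ∧ Φ.coefIn 𝔸 ∧ Φ.realization = f}

/-- `R(d,W,L,B,s)`: realizations with width ≤ `W`, depth ≤ `L`, weight magnitude ≤ `B`,
and connectivity ≤ `s`. -/
def RclassSparse (d W L : ℕ) (B : ℝ) (s : ℕ) : Set ((Fin d → ℝ) → ℝ) :=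
  {f | ∃ Φ : ReLUNet d, Φ.widthLe W ∧ Φ.depth ≤ L ∧ Φ.magLe B ∧
    Φ.connectivity ≤ s ∧ Φ.realization = f}

/-- The unit cube `[0,1]^d`. -/
def unitCube (d : ℕ) : Set (Fin d → ℝ) := Set.univ.pi fun _ => Set.Icc (0 : ℝ) 1

/-- The `L^p([0,1]^d)` distance between two functions on `ℝ^d` (with `p = ⊤`
corresponding to `L^∞`). -/
def cubeDist (d : ℕ) (p : ℝ≥0∞) (f g : (Fin d → ℝ) → ℝ) : ℝ≥0∞ :=
  eLpNorm (f - g) p (volume.restrict (unitCube d))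

/-- The `L^p([0,1])` distance between two functions on `ℝ`. -/
def intervalDist (p : ℝ≥0∞) (f g : ℝ → ℝ) : ℝ≥0∞ :=
  eLpNorm (f - g) p (volume.restrict (Set.Icc (0 : ℝ) 1))

/-- The `ε`-covering number of `X` with respect to the extended distance `δ`:
the cardinality of a smallest subset `C ⊆ X` such that every point of `X` is within
distance `ε` of some point of `C` (equal to `⊤` if no finite covering exists). -/
def coveringNumber {α : Type*} (ε : ℝ≥0∞) (X : Set α) (δ : α → α → ℝ≥0∞) : ℕ∞ :=
  sInf {n : ℕ∞ | ∃ C : Finset α, ↑C ⊆ X ∧ (∀ x ∈ X, ∃ c ∈ C, δ x c ≤ ε) ∧ (C.card : ℕ∞) = n}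

/-- The `ε`-packing number of `X` with respect to the extended distance `δ`:
the cardinality of a largest subset of `X` whose points have pairwise distances `> ε`. -/
def packingNumber {α : Type*} (ε : ℝ≥0∞) (X : Set α) (δ : α → α → ℝ≥0∞) : ℕ∞ :=
  sSup {n : ℕ∞ | ∃ C : Finset α, ↑C ⊆ X ∧
    (∀ x ∈ C, ∀ y ∈ C, x ≠ y → ε < δ x y) ∧ (C.card : ℕ∞) = n}

/-- Base-2 logarithm of an extended natural number, valued in `ℝ≥0∞`. -/
def elog2 (n : ℕ∞) : ℝ≥0∞ :=
  if n = ⊤ then ⊤ else ENNReal.ofReal (Real.logb 2 (n.toNat : ℝ))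

/-- The minimax approximation error `A(G, F, δ) = sup_{g ∈ G} inf_{f ∈ F} δ(f, g)`. -/
def minimaxErr {α : Type*} (G F : Set α) (δ : α → α → ℝ≥0∞) : ℝ≥0∞ :=
  ⨆ g ∈ G, ⨅ f ∈ F, δ f g

/-- `Q_b^a = (−2^{a+1}, 2^{a+1}) ∩ 2^{−b}ℤ`: the base-2 quantized weight set. -/
def Qset (a b : ℕ) : Set ℝ :=
  {x | x ∈ Set.Ioo (-((2 : ℝ) ^ (a + 1))) ((2 : ℝ) ^ (a + 1)) ∧
    ∃ k : ℤ, x = (k : ℝ) * (2 : ℝ) ^ (-(b : ℤ))}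

/-- `R_b^a(d,W,L) = R_{Q_b^a}(d,W,L)`: realizations of ReLU networks with base-2
quantized weights. -/
def RclassQ (d W L a b : ℕ) : Set ((Fin d → ℝ) → ℝ) := RclassCoef d W L (Qset a b)

theorem elog2_le_of_le {n : ℕ∞} {N : ℕ} (h : n ≤ N) :
    elog2 n ≤ ENNReal.ofReal (Real.logb 2 N) := by
  have hn : n ≠ ⊤ := ne_top_of_le_ne_top (ENat.natCast_ne_top N) h
  rw [elog2, if_neg hn]
  apply ENNReal.ofReal_le_ofReal
  lift n to ℕ using hn
  have h' : n ≤ N := by exact_mod_cast h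
  rcases Nat.eq_zero_or_pos n with rfl | h0
  · simp only [ENat.toNat_zero, CharP.cast_eq_zero, Real.logb_zero]
    rcases Nat.eq_zero_or_pos N with rfl | hN
    · simp
    · exact Real.logb_nonneg (by norm_num) (by exact_mod_cast hN)
  · exact Real.logb_le_logb_of_le (by norm_num) (by simpa using h0) (by simpa using h')

theorem le_elog2_of_le {n : ℕ∞} {N : ℕ} (hN : 0 < N) (h : (N : ℕ∞) ≤ n) :
    ENNReal.ofReal (Real.logb 2 N) ≤ elog2 n := by
  rw [elog2]
  split_ifs with hn
  · exact le_top
  · apply ENNReal.ofReal_le_ofReal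
    lift n to ℕ using hn
    have h' : N ≤ n := by exact_mod_cast h
    exact Real.logb_le_logb_of_le (by norm_num) (by simpa using hN) (by simpa using h')

theorem volume_unitCube (d : ℕ) : volume (unitCube d) = 1 := by
  rw [unitCube, volume_pi_pi]
  simp

instance isProbabilityMeasure_restrict_unitCube (d : ℕ) :
    IsProbabilityMeasure (volume.restrict (unitCube d)) :=
  ⟨by rw [Measure.restrict_apply_univ, volume_unitCube]⟩

theorem measurableSet_unitCube (d : ℕ) : MeasurableSet (unitCube d) :=
  MeasurableSet.univ_pi fun _ => measurableSet_Icc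

theorem cubeDist_le_of_forall {d : ℕ} {p : ℝ≥0∞} {f g : (Fin d → ℝ) → ℝ} {ε : ℝ}
    (h : ∀ x ∈ unitCube d, |f x - g x| ≤ ε) : cubeDist d p f g ≤ ENNReal.ofReal ε := by
  have h1 : ∀ᵐ x ∂(volume.restrict (unitCube d)), ‖(f - g) x‖ ≤ ε := by
    rw [ae_restrict_iff' (measurableSet_unitCube d)]
    exact Filter.Eventually.of_forall fun x hx => h x hx
  have h2 := eLpNorm_le_of_ae_bound (p := p) h1
  simpa [cubeDist] using h2

/-- Forward pass of a network of constant width `W`, with weights indexed by natural numbers. -/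
def paddedForward (W : ℕ) (M : ℕ → ℕ → ℕ → ℝ) (c : ℕ → ℕ → ℝ) : ℕ → (ℕ → ℝ) → ℕ → ℝ
  | 0, x => x
  | i + 1, x => fun j =>
      (∑ k ∈ Finset.range W,
        M i j k * (if i = 0 then paddedForward W M c i x k
          else max (paddedForward W M c i x k) 0)) + c i j

theorem paddedForward_congr {W l : ℕ} {M M' : ℕ → ℕ → ℕ → ℝ} {c c' : ℕ → ℕ → ℝ}
    (hM : ∀ i < l, ∀ j < W, ∀ k < W, M i j k = M' i j k)
    (hc : ∀ i < l, ∀ j < W, c i j = c' i j) (x : ℕ → ℝ) :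
    ∀ i ≤ l, ∀ j < W, paddedForward W M c i x j = paddedForward W M' c' i x j := by
  intro i
  induction i with
  | zero => intros; rfl
  | succ i ih =>
    intro hi j hj
    simp only [paddedForward]
    rw [hc i hi j hj]
    congr 1
    refine Finset.sum_congr rfl fun k hk => ?_
    rw [Finset.mem_range] at hk
    rw [hM i hi j hj k hk, ih (by omega) k hk]

namespace ReLUNet

variable {d : ℕ}

/-- Weights of a configuration, extended by zero. -/
def padA (Φ : ReLUNet d) (i j k : ℕ) : ℝ :=
  if h : j < Φ.width (i + 1) ∧ k < Φ.width i then Φ.A i ⟨j, h.1⟩ ⟨k, h.2⟩ else 0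

/-- Biases of a configuration, extended by zero. -/
def padb (Φ : ReLUNet d) (i j : ℕ) : ℝ :=
  if h : j < Φ.width (i + 1) then Φ.b i ⟨j, h⟩ else 0

theorem forward_eq_paddedForward (Φ : ReLUNet d) {W : ℕ} (hW : Φ.widthLe W)
    (x : Fin (Φ.width 0) → ℝ) (y : ℕ → ℝ) (hy : ∀ k, y k.val = x k) :
    ∀ i ≤ Φ.depth, ∀ j : Fin (Φ.width i),
      Φ.forward i x j = paddedForward W Φ.padA Φ.padb i y j := by
  intro i
  induction i with
  | zero => intro _ j; exact (hy j).symm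
  | succ i ih =>
    intro hi j
    simp only [forward, layer, paddedForward]
    have hb : Φ.padb i j = Φ.b i j := by simp [padb]
    rw [hb]
    congr 1
    have hsub : Finset.range (Φ.width i) ⊆ Finset.range W :=
      Finset.range_subset_range.2 (hW i (by omega))
    rw [← Finset.sum_subset hsub]
    · rw [← Fin.sum_univ_eq_sum_range (fun k => Φ.padA i j k *
        (if i = 0 then paddedForward W Φ.padA Φ.padb i y k
          else max (paddedForward W Φ.padA Φ.padb i y k) 0))]
      refine Finset.sum_congr rfl fun k _ => ?_
      rw [← ih (by omega) k]
      simp [padA]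
    · intro k _ hk
      rw [Finset.mem_range] at hk
      simp [padA, hk]

theorem realization_eq_paddedForward (Φ : ReLUNet d) {W : ℕ} (hW : Φ.widthLe W)
    (x : Fin d → ℝ) :
    Φ.realization x = paddedForward W Φ.padA Φ.padb Φ.depth
      (fun k => if h : k < d then x ⟨k, h⟩ else 0) 0 := by
  rw [realization, Φ.forward_eq_paddedForward hW _ (fun k => if h : k < d then x ⟨k, h⟩ else 0)]
  · rfl
  · intro k
    have : k.val < d := lt_of_lt_of_eq k.2 Φ.width_in
    simp only [this, dif_pos]
    rfl
  · exact le_rfl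

end ReLUNet

theorem zero_mem_Qset (a b : ℕ) : (0 : ℝ) ∈ Qset a b :=
  ⟨⟨by simp, by positivity⟩, 0, by simp⟩

/-- The quantized weights as a finite set. -/
def Qfinset (a b : ℕ) : Finset ℝ :=
  (Finset.Ioo (-(2 : ℤ) ^ (a + b + 1)) (2 ^ (a + b + 1))).image
    fun k : ℤ => (k : ℝ) * (2 : ℝ) ^ (-(b : ℤ))

theorem mem_Qfinset_of_mem_Qset {a b : ℕ} {x : ℝ} (hx : x ∈ Qset a b) : x ∈ Qfinset a b := by
  obtain ⟨⟨h1, h2⟩, k, rfl⟩ := hx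
  refine Finset.mem_image.2 ⟨k, ?_, rfl⟩
  have hb : (0 : ℝ) < 2 ^ b := by positivity
  rw [zpow_neg, zpow_natCast, ← div_eq_mul_inv] at h1 h2
  rw [div_lt_iff₀ hb] at h2
  rw [lt_div_iff₀ hb] at h1
  rw [Finset.mem_Ioo]
  have e : (2 : ℝ) ^ (a + 1) * 2 ^ b = 2 ^ (a + b + 1) := by ring
  constructor
  · have : (-(2 : ℝ) ^ (a + b + 1)) < k := by rw [← e]; linarith
    exact_mod_cast this
  · rw [e] at h2
    exact_mod_cast h2

theorem card_Qfinset_le (a b : ℕ) : (Qfinset a b).card ≤ 2 ^ (a + b + 2) := by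
  refine Finset.card_image_le.trans ?_
  rw [Int.card_Ioo]
  have : (2 : ℤ) ^ (a + b + 1) - -(2 : ℤ) ^ (a + b + 1) - 1 = 2 ^ (a + b + 2) - 1 := by ring
  rw [this, Int.toNat_le]
  push_cast
  linarith

theorem RclassQ_finite_ncard_le (d W L a b : ℕ) (hW : 0 < W) :
    (RclassQ d W L a b).Finite ∧
      (RclassQ d W L a b).ncard ≤ (L + 1) * (2 ^ (a + b + 2)) ^ (L * (W * (W + 1))) := by
  let P := Fin (L + 1) × (Fin L × Fin W × Option (Fin W) → Qfinset a b)
  let G : P → (Fin d → ℝ) → ℝ := fun q x =>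
    paddedForward W
      (fun i j k => if h : i < L ∧ j < W ∧ k < W then
        (q.2 (⟨i, h.1⟩, ⟨j, h.2.1⟩, some ⟨k, h.2.2⟩) : ℝ) else 0)
      (fun i j => if h : i < L ∧ j < W then (q.2 (⟨i, h.1⟩, ⟨j, h.2⟩, none) : ℝ) else 0)
      q.1 (fun k => if h : k < d then x ⟨k, h⟩ else 0) 0
  have hsub : RclassQ d W L a b ⊆ Set.range G := by
    rintro f ⟨Φ, hw, hd, hc, rfl⟩
    classical
    let φ : ℝ → Qfinset a b := fun x => if h : x ∈ Qfinset a b then ⟨x, h⟩ else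
      ⟨0, mem_Qfinset_of_mem_Qset (zero_mem_Qset a b)⟩
    have hφ : ∀ x ∈ Qset a b, (φ x : ℝ) = x := fun x hx => by
      simp [φ, mem_Qfinset_of_mem_Qset hx]
    refine ⟨(⟨Φ.depth, by omega⟩, fun t => match t.2.2 with
      | none => φ (Φ.padb t.1 t.2.1)
      | some k => φ (Φ.padA t.1 t.2.1 k)), ?_⟩
    funext x
    rw [Φ.realization_eq_paddedForward hw]
    refine paddedForward_congr (l := Φ.depth) ?_ ?_ _ _ le_rfl _ hW
    · intro i hi j hj k hk
      have h1 : i < L ∧ j < W ∧ k < W := ⟨by omega, hj, hk⟩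
      rw [dif_pos h1]
      apply hφ
      rw [ReLUNet.padA]
      split_ifs
      · exact (hc i hi).1 _ _
      · exact zero_mem_Qset a b
    · intro i hi j hj
      have h1 : i < L ∧ j < W := ⟨by omega, hj⟩
      rw [dif_pos h1]
      apply hφ
      rw [ReLUNet.padb]
      split_ifs
      · exact (hc i hi).2 _
      · exact zero_mem_Qset a b
  have hfin : (Set.range G).Finite := Set.finite_range G
  refine ⟨hfin.subset hsub, (Set.ncard_le_ncard hsub hfin).trans ?_⟩
  calc (Set.range G).ncard ≤ Nat.card P := by
        rw [← Set.image_univ, ← Set.ncard_univ]; exact Set.ncard_image_le Set.finite_univ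
    _ = (L + 1) * (Qfinset a b).card ^ (L * (W * (W + 1))) := by
        simp [P, Nat.card_eq_fintype_card]
    _ ≤ _ := by gcongr; exact card_Qfinset_le a b

namespace ReLUNet

variable {d : ℕ}

/-- Apply a function to every weight of a configuration. -/
def mapWeights (Φ : ReLUNet d) (r : ℝ → ℝ) : ReLUNet d where
  depth := Φ.depth
  depth_pos := Φ.depth_pos
  width := Φ.width
  width_in := Φ.width_in
  width_out := Φ.width_out
  A := fun i j k => r (Φ.A i j k)
  b := fun i j => r (Φ.b i j)

theorem abs_forward_le (Φ : ReLUNet d) {W : ℕ} {B : ℝ} (hW : Φ.widthLe W) (hB : 1 ≤ B)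
    (hΦ : Φ.magLe B) (x : Fin (Φ.width 0) → ℝ) (hx : ∀ k, |x k| ≤ 1) :
    ∀ i ≤ Φ.depth, ∀ j, |Φ.forward i x j| ≤ (((W : ℝ) + 1) * B) ^ i := by
  intro i
  induction i with
  | zero => intro _ j; simpa [forward] using hx j
  | succ i ih =>
    intro hi j
    set V := (((W : ℝ) + 1) * B) ^ i with hV
    have hV1 : 1 ≤ V := one_le_pow₀ (by nlinarith [(Nat.cast_nonneg W : (0 : ℝ) ≤ W)])
    have hwi : (Φ.width i : ℝ) ≤ W := by exact_mod_cast hW i (by omega)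
    obtain ⟨hA, hb⟩ := hΦ i (by omega)
    simp only [forward, layer]
    have hterm : ∀ k, |Φ.A i j k * (if i = 0 then Φ.forward i x k
        else max (Φ.forward i x k) 0)| ≤ B * V := by
      intro k
      rw [abs_mul]
      refine mul_le_mul (hA j k) ?_ (abs_nonneg _) (by linarith)
      have h := ih (by omega) k
      split_ifs
      · exact h
      · rw [abs_le] at h ⊢
        exact ⟨le_trans (by linarith) (le_max_right _ _), max_le h.2 (by linarith)⟩
    calc _ ≤ |∑ k, Φ.A i j k * (if i = 0 then Φ.forward i x k
            else max (Φ.forward i x k) 0)| + |Φ.b i j| := abs_add_le _ _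
      _ ≤ (∑ _k : Fin (Φ.width i), B * V) + B := by
          refine add_le_add ((Finset.abs_sum_le_sum_abs _ _).trans ?_) (hb j)
          exact Finset.sum_le_sum fun k _ => hterm k
      _ = Φ.width i * (B * V) + B := by simp
      _ ≤ W * (B * V) + B * V := by
          have : 0 ≤ B * V := by positivity
          nlinarith
      _ = (((W : ℝ) + 1) * B) ^ (i + 1) := by rw [pow_succ, ← hV]; ring

theorem abs_forward_sub_le (Φ : ReLUNet d) {W : ℕ} {B δ : ℝ} (hW : Φ.widthLe W) (hB : 1 ≤ B)
    (hΦ : Φ.magLe B) {r : ℝ → ℝ} (hr : ∀ y, |y - r y| ≤ δ) (hr' : ∀ y, |r y| ≤ |y|)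
    (x : Fin (Φ.width 0) → ℝ) (hx : ∀ k, |x k| ≤ 1) :
    ∀ i ≤ Φ.depth, ∀ j, |Φ.forward i x j - (Φ.mapWeights r).forward i x j| ≤
      i * δ * (((W : ℝ) + 1) * B) ^ i := by
  have hδ : 0 ≤ δ := (abs_nonneg _).trans (hr 0)
  intro i
  induction i with
  | zero => intro _ j; simp [forward]
  | succ i ih =>
    intro hi j
    set V := (((W : ℝ) + 1) * B) ^ i with hV
    have hV1 : 1 ≤ V := one_le_pow₀ (by nlinarith [(Nat.cast_nonneg W : (0 : ℝ) ≤ W)])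
    have hwi : (Φ.width i : ℝ) ≤ W := by exact_mod_cast hW i (by omega)
    obtain ⟨hA, hb⟩ := hΦ i (by omega)
    have hf := Φ.abs_forward_le hW hB hΦ x hx i (by omega)
    have ih' := ih (by omega)
    simp only [forward, layer]
    have hterm : ∀ (a u v : ℝ), |a| ≤ B → |u| ≤ V → |u - v| ≤ i * δ * V →
        |a * u - r a * v| ≤ B * (i * δ * V) + δ * V := by
      intro a u v ha hu huv
      have e : a * u - r a * v = r a * (u - v) + (a - r a) * u := by ring
      rw [e]
      refine (abs_add_le _ _).trans ?_
      rw [abs_mul, abs_mul]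
      refine add_le_add (mul_le_mul ((hr' a).trans ha) huv (abs_nonneg _) (by linarith))
        (mul_le_mul (hr a) hu (abs_nonneg _) hδ)
    have hterm' : ∀ k : Fin (Φ.width i), |Φ.A i j k * (if i = 0 then Φ.forward i x k
        else max (Φ.forward i x k) 0) - r (Φ.A i j k) *
          (if i = 0 then (Φ.mapWeights r).forward i x k
            else max ((Φ.mapWeights r).forward i x k) 0)| ≤ B * (i * δ * V) + δ * V := by
      intro k
      split_ifs
      · exact hterm _ _ _ (hA j k) (hf k) (ih' k)
      · refine hterm _ _ _ (hA j k) ?_ ?_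
        · have h := hf k
          rw [abs_le] at h ⊢
          exact ⟨le_trans (by linarith) (le_max_right _ _), max_le h.2 (by linarith)⟩
        · exact (abs_max_sub_max_le_abs _ _ _).trans (ih' k)
    calc _ = |(∑ k, (Φ.A i j k * (if i = 0 then Φ.forward i x k
              else max (Φ.forward i x k) 0) - r (Φ.A i j k) *
          (if i = 0 then (Φ.mapWeights r).forward i x k
            else max ((Φ.mapWeights r).forward i x k) 0))) + (Φ.b i j - r (Φ.b i j))| := by
          rw [Finset.sum_sub_distrib]
          exact congrArg _ (add_sub_add_comm _ _ _ _)
      _ ≤ (∑ _k : Fin (Φ.width i), (B * (i * δ * V) + δ * V)) + δ := by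
          refine (abs_add_le _ _).trans ?_
          refine add_le_add ((Finset.abs_sum_le_sum_abs _ _).trans ?_) (hr _)
          exact Finset.sum_le_sum fun k _ => hterm' k
      _ = Φ.width i * (B * (i * δ * V) + δ * V) + δ := by
          rw [Finset.sum_const, Finset.card_univ, Fintype.card_fin, nsmul_eq_mul]
      _ ≤ W * (B * (i * δ * V) + B * (δ * V)) + B * (δ * V) + B * (i * δ * V) := by
          have h0 : 0 ≤ δ * V := by positivity
          have h1 : 0 ≤ B * (i * δ * V) := by positivity
          have h2 : δ ≤ δ * V := le_mul_of_one_le_right hδ hV1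
          have h3 : δ * V ≤ B * (δ * V) := le_mul_of_one_le_left h0 hB
          have h4 : (Φ.width i : ℝ) * (B * (i * δ * V) + δ * V) ≤
            W * (B * (i * δ * V) + B * (δ * V)) := by gcongr
          linarith
      _ = ((i + 1 : ℕ) : ℝ) * δ * (((W : ℝ) + 1) * B) ^ (i + 1) := by
          rw [pow_succ, ← hV]; push_cast; ring

end ReLUNet

/-- Rounding towards zero to a multiple of `2 ^ (-b)`. -/
def roundToward (b : ℕ) (x : ℝ) : ℝ :=
  (if 0 ≤ x then (⌊x * 2 ^ b⌋ : ℝ) else (⌈x * 2 ^ b⌉ : ℝ)) * (2 : ℝ) ^ (-(b : ℤ))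

theorem abs_sub_roundToward_le (b : ℕ) (x : ℝ) :
    |x - roundToward b x| ≤ (2 : ℝ) ^ (-(b : ℤ)) := by
  have hb : (0 : ℝ) < 2 ^ b := by positivity
  have e : x = x * 2 ^ b * (2 : ℝ) ^ (-(b : ℤ)) := by
    rw [zpow_neg, zpow_natCast]; field_simp
  have hp : (0 : ℝ) < (2 : ℝ) ^ (-(b : ℤ)) := by positivity
  rw [roundToward]
  nth_rewrite 1 [e]
  rw [← sub_mul, abs_mul, abs_of_pos hp]
  refine mul_le_of_le_one_left hp.le ?_
  split_ifs
  · rw [abs_le]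
    constructor <;> linarith [Int.floor_le (x * 2 ^ b), Int.lt_floor_add_one (x * 2 ^ b)]
  · rw [abs_le]
    constructor <;> linarith [Int.le_ceil (x * 2 ^ b), Int.ceil_lt_add_one (x * 2 ^ b)]

theorem abs_roundToward_le (b : ℕ) (x : ℝ) : |roundToward b x| ≤ |x| := by
  have hb : (0 : ℝ) < 2 ^ b := by positivity
  have e : x = x * 2 ^ b * (2 : ℝ) ^ (-(b : ℤ)) := by
    rw [zpow_neg, zpow_natCast]; field_simp
  have hp : (0 : ℝ) < (2 : ℝ) ^ (-(b : ℤ)) := by positivity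
  rw [roundToward, abs_mul]
  conv_rhs => rw [e, abs_mul]
  refine mul_le_mul_of_nonneg_right ?_ (abs_nonneg _)
  split_ifs with h
  · have : (0 : ℝ) ≤ ⌊x * 2 ^ b⌋ := by
      exact_mod_cast Int.floor_nonneg.2 (mul_nonneg h hb.le)
    rw [abs_of_nonneg this, abs_of_nonneg (mul_nonneg h hb.le)]
    exact Int.floor_le _
  · have h' : x * 2 ^ b ≤ 0 := mul_nonpos_of_nonpos_of_nonneg (by linarith) hb.le
    have : (⌈x * 2 ^ b⌉ : ℝ) ≤ 0 := by exact_mod_cast Int.ceil_le.2 (by simpa using h')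
    rw [abs_of_nonpos this, abs_of_nonpos h']
    linarith [Int.le_ceil (x * 2 ^ b)]

theorem roundToward_mem_Qset {a b b' : ℕ} {x : ℝ} (hx : x ∈ Qset a b) :
    roundToward b' x ∈ Qset a b' := by
  refine ⟨?_, ?_⟩
  · have h1 : |x| < 2 ^ (a + 1) := abs_lt.2 hx.1
    exact abs_lt.1 ((abs_roundToward_le b' x).trans_lt h1)
  · rw [roundToward]
    split_ifs
    · exact ⟨_, rfl⟩
    · exact ⟨_, rfl⟩

theorem Qset_mono {a b b' : ℕ} (h : b' ≤ b) : Qset a b' ⊆ Qset a b := by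
  rintro x ⟨hx, k, rfl⟩
  refine ⟨hx, k * 2 ^ (b - b'), ?_⟩
  obtain ⟨c, rfl⟩ := Nat.exists_eq_add_of_le h
  simp only [zpow_neg, zpow_natCast, add_tsub_cancel_left]
  push_cast
  rw [pow_add]
  field_simp

theorem RclassQ_mono {d W L a b b' : ℕ} (h : b' ≤ b) :
    RclassQ d W L a b' ⊆ RclassQ d W L a b := by
  rintro f ⟨Φ, h1, h2, h3, h4⟩
  exact ⟨Φ, h1, h2, fun i hi => ⟨fun j k => Qset_mono h ((h3 i hi).1 j k),
    fun j => Qset_mono h ((h3 i hi).2 j)⟩, h4⟩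

theorem exists_cubeDist_le_of_mem_RclassQ {d W L a b : ℕ} (b' : ℕ) (p : ℝ≥0∞)
    {f : (Fin d → ℝ) → ℝ} (hf : f ∈ RclassQ d W L a b) :
    ∃ g ∈ RclassQ d W L a b', cubeDist d p f g ≤
      ENNReal.ofReal (L * (2 : ℝ) ^ (-(b' : ℤ)) * (((W : ℝ) + 1) * 2 ^ (a + 1)) ^ L) := by
  obtain ⟨Φ, h1, h2, h3, rfl⟩ := hf
  refine ⟨(Φ.mapWeights (roundToward b')).realization, ⟨Φ.mapWeights (roundToward b'), h1, h2,
    fun i hi => ⟨fun j k => roundToward_mem_Qset ((h3 i hi).1 j k),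
      fun j => roundToward_mem_Qset ((h3 i hi).2 j)⟩, rfl⟩, ?_⟩
  apply cubeDist_le_of_forall
  intro x hx
  have hB : (1 : ℝ) ≤ 2 ^ (a + 1) := one_le_pow₀ (by norm_num)
  have hmag : Φ.magLe (2 ^ (a + 1)) := fun i hi =>
    ⟨fun j k => (abs_lt.2 ((h3 i hi).1 j k).1).le, fun j => (abs_lt.2 ((h3 i hi).2 j).1).le⟩
  refine (Φ.abs_forward_sub_le h1 hB hmag (abs_sub_roundToward_le b') (abs_roundToward_le b')
    _ ?_ Φ.depth le_rfl _).trans ?_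
  · intro k
    have := hx (Fin.cast Φ.width_in k) (Set.mem_univ _)
    rw [abs_le]
    exact ⟨by linarith [this.1], this.2⟩
  · have : (1 : ℝ) ≤ ((W : ℝ) + 1) * 2 ^ (a + 1) := by
      nlinarith [(Nat.cast_nonneg W : (0 : ℝ) ≤ W)]
    gcongr

theorem coveringNumber_RclassQ_le {d W L a b : ℕ} (hW : 0 < W) (b' : ℕ) {ε : ℝ} (p : ℝ≥0∞)
    (h : L * (2 : ℝ) ^ (-(b' : ℤ)) * (((W : ℝ) + 1) * 2 ^ (a + 1)) ^ L ≤ ε) :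
    coveringNumber (ENNReal.ofReal ε) (RclassQ d W L a b) (cubeDist d p) ≤
      (((L + 1) * (2 ^ (a + min b b' + 2)) ^ (L * (W * (W + 1))) : ℕ) : ℕ∞) := by
  obtain ⟨hfin, hcard⟩ := RclassQ_finite_ncard_le d W L a (min b b') hW
  have : ((hfin.toFinset.card : ℕ) : ℕ∞) ≤
      (((L + 1) * (2 ^ (a + min b b' + 2)) ^ (L * (W * (W + 1))) : ℕ) : ℕ∞) := by
    rw [Set.ncard_eq_toFinset_card _ hfin] at hcard
    exact_mod_cast hcard
  refine le_trans (sInf_le ⟨hfin.toFinset, ?_, ?_, rfl⟩) this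
  · rw [Set.Finite.coe_toFinset]
    exact RclassQ_mono (min_le_left _ _)
  · intro f hf
    rcases le_total b b' with hb | hb
    · refine ⟨f, ?_, by simp [cubeDist]⟩
      rwa [Set.Finite.mem_toFinset, min_eq_left hb]
    · obtain ⟨g, hg, hfg⟩ := exists_cubeDist_le_of_mem_RclassQ b' p hf
      refine ⟨g, ?_, hfg.trans (ENNReal.ofReal_le_ofReal h)⟩
      rw [Set.Finite.mem_toFinset, min_eq_right hb]
      exact hg

theorem logb_weight_resolution {W L a : ℕ} {ε : ℝ} (hε : 0 < ε) :
    Real.logb 2 (((W : ℝ) + 1) ^ L * (2 : ℝ) ^ (a * L) / ε) =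
      L * Real.logb 2 ((W : ℝ) + 1) + a * L - Real.logb 2 ε := by
  have hW : (0 : ℝ) < (W : ℝ) + 1 := by positivity
  rw [Real.logb_div (by positivity) hε.ne', Real.logb_mul (by positivity) (by positivity),
    Real.logb_pow, Real.logb_pow, Real.logb_self_eq_one (by norm_num)]
  push_cast
  ring

theorem logb_two_natCast_le (n : ℕ) : Real.logb 2 n ≤ n := by
  rcases Nat.eq_zero_or_pos n with rfl | hn
  · simp
  · rw [Real.logb_le_iff_le_rpow (by norm_num) (by exact_mod_cast hn), Real.rpow_natCast]
    exact_mod_cast Nat.lt_two_pow_self.le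

theorem elog2_coveringNumber_RclassQ_le (p : ℝ≥0∞) {d W L a b : ℕ} {ε : ℝ} (hd : 0 < d)
    (hL : 0 < L) (hdW : d ≤ W) (hb : 0 < b) (hε : 0 < ε) (hε' : ε < 1 / 2) :
    elog2 (coveringNumber (ENNReal.ofReal ε) (RclassQ d W L a b) (cubeDist d p))
      ≤ ENNReal.ofReal
          (13 * ((W : ℝ) ^ 2 * L) *
            min ((a : ℝ) + b)
              (Real.logb 2 (((W : ℝ) + 1) ^ L * (2 : ℝ) ^ (a * L) / ε))) := by
  have hW : 0 < W := by omega
  have hW1 : (1 : ℝ) ≤ W := by exact_mod_cast hW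
  have hL1 : (1 : ℝ) ≤ L := by exact_mod_cast hL
  have hb1 : (1 : ℝ) ≤ b := by exact_mod_cast hb
  have ha0 : (0 : ℝ) ≤ a := Nat.cast_nonneg a
  set T := Real.logb 2 (((W : ℝ) + 1) ^ L * (2 : ℝ) ^ (a * L) / ε) with hT
  have hTe := logb_weight_resolution (W := W) (L := L) (a := a) hε
  rw [← hT] at hTe
  have hlogW : 1 ≤ Real.logb 2 ((W : ℝ) + 1) := by
    rw [Real.le_logb_iff_rpow_le (by norm_num) (by positivity)]
    norm_num
    linarith
  have hlogε : Real.logb 2 ε ≤ -1 := by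
    rw [Real.logb_le_iff_le_rpow (by norm_num) hε, Real.rpow_neg_one]
    linarith
  have hT1 : L + a * L + 1 ≤ T := by nlinarith
  have haT : (a : ℝ) + 2 ≤ T := by nlinarith
  set U := (L : ℝ) * (((W : ℝ) + 1) * 2 ^ (a + 1)) ^ L / ε with hU
  have hU0 : 0 < U := by positivity
  have hlogU : Real.logb 2 U = Real.logb 2 L + L + T := by
    have : U = (L : ℝ) * 2 ^ L * (((W : ℝ) + 1) ^ L * (2 : ℝ) ^ (a * L) / ε) := by
      rw [hU, mul_pow, ← pow_mul, add_mul, one_mul, pow_add]; ring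
    rw [this, Real.logb_mul (by positivity) (by positivity),
      Real.logb_mul (by positivity) (by positivity), Real.logb_pow,
      Real.logb_self_eq_one (by norm_num), mul_one]
  have hlogL := logb_two_natCast_le L
  have hlogL0 : 0 ≤ Real.logb 2 (L : ℝ) := Real.logb_nonneg (by norm_num) hL1
  set b' := ⌈Real.logb 2 U⌉₊ with hb'
  have hb'1 : (b' : ℝ) ≤ 3 * T := by
    have := Nat.ceil_lt_add_one (a := Real.logb 2 U) (by rw [hlogU]; linarith)
    rw [← hb', hlogU] at this
    nlinarith
  have hres : L * (2 : ℝ) ^ (-(b' : ℤ)) * (((W : ℝ) + 1) * 2 ^ (a + 1)) ^ L ≤ ε := by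
    have h1 : U ≤ 2 ^ b' := by
      have := Nat.le_ceil (Real.logb 2 U)
      rw [← hb', Real.logb_le_iff_le_rpow (by norm_num) hU0, Real.rpow_natCast] at this
      exact this
    rw [hU, div_le_iff₀ hε] at h1
    rw [zpow_neg, zpow_natCast, mul_right_comm, ← div_eq_mul_inv, div_le_iff₀ (by positivity)]
    linarith
  refine (elog2_le_of_le (coveringNumber_RclassQ_le hW b' p hres)).trans ?_
  apply ENNReal.ofReal_le_ofReal
  push_cast
  rw [Real.logb_mul (by positivity) (by positivity), Real.logb_pow, Real.logb_pow,
    Real.logb_self_eq_one (by norm_num)]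
  have hlogL' : Real.logb 2 ((L : ℝ) + 1) ≤ L := by
    rw [Real.logb_le_iff_le_rpow (by norm_num) (by positivity), Real.rpow_natCast]
    exact_mod_cast Nat.lt_two_pow_self
  have hN0 : (0 : ℝ) ≤ W ^ 2 * L := by positivity
  have hN1 : (L : ℝ) ≤ W ^ 2 * L := le_mul_of_one_le_left (by linarith) (one_le_pow₀ hW1)
  set μ := ((a + min b b' + 2 : ℕ) : ℝ) with hμ
  have hμ0 : 0 ≤ μ := Nat.cast_nonneg _
  have h2 : (L : ℝ) * (W * (W + 1)) * μ ≤ 2 * (W ^ 2 * L) * μ := by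
    refine mul_le_mul_of_nonneg_right ?_ hμ0
    have : (L : ℝ) * (W * (W + 1)) ≤ L * (2 * W ^ 2) :=
      mul_le_mul_of_nonneg_left (by nlinarith) (by linarith)
    linarith
  have hμ1 : 1 + 2 * μ ≤ 13 * min ((a : ℝ) + b) T := by
    rw [mul_min_of_nonneg _ _ (by norm_num)]
    refine le_min ?_ ?_
    · have : μ ≤ a + b + 2 := by
        rw [hμ]; exact_mod_cast (by omega : a + min b b' + 2 ≤ a + b + 2)
      linarith
    · have : μ ≤ a + b' + 2 := by
        rw [hμ]; exact_mod_cast (by omega : a + min b b' + 2 ≤ a + b' + 2)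
      linarith
  calc _ ≤ W ^ 2 * L + 2 * (W ^ 2 * L) * μ := by
        push_cast at h2 hμ ⊢
        rw [hμ] at h2 ⊢
        linarith
    _ = W ^ 2 * L * (1 + 2 * μ) := by ring
    _ ≤ W ^ 2 * L * (13 * min ((a : ℝ) + b) T) := by gcongr
    _ = _ := by ring

/-- Activations of a hidden layer, organized in six groups of `k` neurons. -/
abbrev GroupState (k : ℕ) : Type := Fin 6 → Fin k → ℝ

/-- Weights between two hidden layers, organized in blocks. -/
abbrev GroupLayer (k : ℕ) : Type := Fin 6 → Fin 6 → Fin k → Fin k → ℝ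

/-- Bias-free layer followed by the ReLU activation. -/
def layerStep {k : ℕ} (M : GroupLayer k) (v : GroupState k) : GroupState k :=
  fun a i => max (∑ b, ∑ j, M a b i j * v b j) 0

/-- Successive application of bias-free layers. -/
def runLayers {k : ℕ} (l : List (GroupLayer k)) (v : GroupState k) : GroupState k :=
  l.foldl (fun v M => layerStep M v) v

/-- Weights of the input coordinate in the first layer. -/
def inputWeight : Fin 6 → ℝ := ![1, 0, 0, 0, 0, 0]

/-- Biases of the first layer. -/
def inputBias : Fin 6 → ℝ := ![0, 1, 1, 1, 0, 0]

/-- Activations of the first hidden layer. -/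
def inputState (k : ℕ) (x : ℝ) : GroupState k :=
  fun a _ => max (inputWeight a * x + inputBias a) 0

/-- Sum of the first group of neurons after all layers. -/
def readout {k : ℕ} (l : List (GroupLayer k)) (x : ℝ) : ℝ :=
  ∑ j, runLayers l (inputState k x) 0 j

theorem layerStep_nonneg {k : ℕ} (M : GroupLayer k) (v : GroupState k) (a : Fin 6) (i : Fin k) :
    0 ≤ layerStep M v a i := le_max_right _ _

theorem runLayers_append {k : ℕ} (l l' : List (GroupLayer k)) (v : GroupState k) :
    runLayers (l ++ l') v = runLayers l' (runLayers l v) := List.foldl_append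

theorem runLayers_cons {k : ℕ} (M : GroupLayer k) (l : List (GroupLayer k)) (v : GroupState k) :
    runLayers (M :: l) v = runLayers l (layerStep M v) := rfl

theorem runLayers_nil {k : ℕ} (v : GroupState k) : runLayers [] v = v := rfl

theorem runLayers_inputState_nonneg {k : ℕ} (l : List (GroupLayer k)) (x : ℝ) (a : Fin 6)
    (i : Fin k) : 0 ≤ runLayers l (inputState k x) a i := by
  induction l using List.reverseRecOn with
  | nil => exact le_max_right _ _
  | append_singleton l M _ =>
    rw [runLayers_append]
    exact layerStep_nonneg _ _ _ _

theorem abs_layerStep_sub_le {k : ℕ} {M : GroupLayer k} (hM : ∀ a b i j, |M a b i j| ≤ 2)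
    {v w : GroupState k} {δ : ℝ} (h : ∀ a i, |v a i - w a i| ≤ δ) (a : Fin 6) (i : Fin k) :
    |layerStep M v a i - layerStep M w a i| ≤ 12 * k * δ := by
  refine (abs_max_sub_max_le_abs _ _ _).trans ?_
  simp only [← Finset.sum_sub_distrib, ← mul_sub]
  calc _ ≤ ∑ b, ∑ j, |M a b i j * (v b j - w b j)| :=
        (Finset.abs_sum_le_sum_abs _ _).trans
          (Finset.sum_le_sum fun b _ => Finset.abs_sum_le_sum_abs _ _)
    _ ≤ ∑ _b : Fin 6, ∑ _j : Fin k, 2 * δ := by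
        refine Finset.sum_le_sum fun b _ => Finset.sum_le_sum fun j _ => ?_
        rw [abs_mul]
        exact mul_le_mul (hM a b i j) (h b j) (abs_nonneg _) (by norm_num)
    _ = 12 * k * δ := by
        simp only [Finset.sum_const, Finset.card_univ, Fintype.card_fin, nsmul_eq_mul]
        push_cast
        ring

theorem abs_runLayers_sub_le {k : ℕ} {l : List (GroupLayer k)}
    (hl : ∀ M ∈ l, ∀ a b i j, |M a b i j| ≤ 2) {v w : GroupState k} {δ : ℝ}
    (h : ∀ a i, |v a i - w a i| ≤ δ) (a : Fin 6) (i : Fin k) :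
    |runLayers l v a i - runLayers l w a i| ≤ (12 * k) ^ l.length * δ := by
  induction l generalizing v w δ with
  | nil => simpa [runLayers] using h a i
  | cons M l ih =>
    rw [runLayers_cons, runLayers_cons]
    refine (ih (fun M' hM' => hl M' (List.mem_cons_of_mem _ hM'))
      (abs_layerStep_sub_le (hl M List.mem_cons_self) h)).trans (le_of_eq ?_)
    rw [List.length_cons, pow_succ]
    ring

theorem abs_readout_sub_le {k : ℕ} {l : List (GroupLayer k)}
    (hl : ∀ M ∈ l, ∀ a b i j, |M a b i j| ≤ 2) (x y : ℝ) :
    |readout l x - readout l y| ≤ k * ((12 * k) ^ l.length * |x - y|) := by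
  have h0 : ∀ (a : Fin 6) (i : Fin k), |inputState k x a i - inputState k y a i| ≤ |x - y| := by
    intro a i
    refine (abs_max_sub_max_le_abs _ _ _).trans ?_
    rw [add_sub_add_right_eq_sub, ← mul_sub, abs_mul]
    refine mul_le_of_le_one_left (abs_nonneg _) ?_
    fin_cases a <;> simp [inputWeight]
  rw [readout, readout, ← Finset.sum_sub_distrib]
  refine (Finset.abs_sum_le_sum_abs _ _).trans ?_
  refine (Finset.sum_le_sum fun j _ => abs_runLayers_sub_le hl h0 0 j).trans (le_of_eq ?_)
  rw [Finset.sum_const, Finset.card_univ, Fintype.card_fin, nsmul_eq_mul]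

/-- Extension by zero of a weight matrix indexed by pairs to natural number indices. -/
def natWeight {k : ℕ} (f : Fin 6 × Fin k → Fin 6 × Fin k → ℝ) (J K : ℕ) : ℝ :=
  if h : J < 6 * k ∧ K < 6 * k then
    f (finProdFinEquiv.symm ⟨J, h.1⟩) (finProdFinEquiv.symm ⟨K, h.2⟩) else 0

theorem natWeight_apply {k : ℕ} (f : Fin 6 × Fin k → Fin 6 × Fin k → ℝ) (p q : Fin 6 × Fin k) :
    natWeight f (finProdFinEquiv p : Fin (6 * k)) (finProdFinEquiv q : Fin (6 * k)) = f p q := by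
  rw [natWeight, dif_pos ⟨Fin.is_lt _, Fin.is_lt _⟩]
  simp only [Fin.eta, Equiv.symm_apply_apply]

theorem natWeight_mem {k : ℕ} {f : Fin 6 × Fin k → Fin 6 × Fin k → ℝ} {s : ℝ} {Q : Set ℝ}
    (h0 : 0 ∈ Q) (h : ∀ p q, s * f p q ∈ Q) (J K : ℕ) : s * natWeight f J K ∈ Q := by
  rw [natWeight]
  split_ifs
  · exact h _ _
  · simpa using h0

/-- The network with hidden layers `l`, all weights being multiplied by `s`. -/
def groupNet {d k : ℕ} (l : List (GroupLayer k)) (s : ℝ) : ReLUNet d where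
  depth := l.length + 2
  depth_pos := by omega
  width := fun i => if i = 0 then d else if i ≤ l.length + 1 then 6 * k else 1
  width_in := by simp
  width_out := by simp
  A := fun i J K =>
    if i = 0 then
      if K.val = 0 then s * natWeight (k := k) (fun p _ => inputWeight p.1) J J else 0
    else if h : i - 1 < l.length then s * natWeight (fun p q => l[i - 1] p.1 q.1 p.2 q.2) J K
    else s * natWeight (k := k) (fun p _ => if p.1 = 0 then 1 else 0) K K
  b := fun i J => if i = 0 then s * natWeight (k := k) (fun p _ => inputBias p.1) J J else 0

theorem groupNet_A_zero {d k : ℕ} (l : List (GroupLayer k)) (s : ℝ)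
    (J : Fin ((groupNet (d := d) l s).width (0 + 1))) (K : Fin ((groupNet (d := d) l s).width 0)) :
    (groupNet (d := d) l s).A 0 J K =
      if K.val = 0 then s * natWeight (k := k) (fun p _ => inputWeight p.1) J J else 0 := rfl

theorem groupNet_A_succ {d k : ℕ} (l : List (GroupLayer k)) (s : ℝ) {i : ℕ} (hi : i < l.length)
    (J : Fin ((groupNet (d := d) l s).width (i + 1 + 1)))
    (K : Fin ((groupNet (d := d) l s).width (i + 1))) :
    (groupNet (d := d) l s).A (i + 1) J K =
      s * natWeight (fun p q => l[i] p.1 q.1 p.2 q.2) J K := by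
  exact dif_pos hi

theorem groupNet_A_length {d k : ℕ} (l : List (GroupLayer k)) (s : ℝ)
    (J : Fin ((groupNet (d := d) l s).width (l.length + 1 + 1)))
    (K : Fin ((groupNet (d := d) l s).width (l.length + 1))) :
    (groupNet (d := d) l s).A (l.length + 1) J K =
      s * natWeight (k := k) (fun p _ => if p.1 = 0 then 1 else 0) K K := by
  exact dif_neg (lt_irrefl l.length)

theorem groupNet_b_zero {d k : ℕ} (l : List (GroupLayer k)) (s : ℝ)
    (J : Fin ((groupNet (d := d) l s).width (0 + 1))) :
    (groupNet (d := d) l s).b 0 J = s * natWeight (k := k) (fun p _ => inputBias p.1) J J := rfl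

theorem groupNet_b_succ {d k : ℕ} (l : List (GroupLayer k)) (s : ℝ) (i : ℕ)
    (J : Fin ((groupNet (d := d) l s).width (i + 1 + 1))) :
    (groupNet (d := d) l s).b (i + 1) J = 0 := rfl

theorem sum_fin_eq_sum_prod {n k : ℕ} (h : n = 6 * k) (f : Fin n → ℝ) :
    ∑ j, f j = ∑ a : Fin 6, ∑ i : Fin k, f (Fin.cast h.symm (finProdFinEquiv (a, i))) := by
  subst h
  rw [← Fintype.sum_prod_type (f := fun p : Fin 6 × Fin k => f (Fin.cast rfl (finProdFinEquiv p)))]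
  exact (Equiv.sum_comp finProdFinEquiv f).symm

theorem max_forward_groupNet {d k : ℕ} (hd : 0 < d) (l : List (GroupLayer k)) {s : ℝ}
    (hs : 0 ≤ s) (x : Fin d → ℝ) :
    ∀ i ≤ l.length, ∀ (J : Fin ((groupNet (d := d) l s).width (i + 1))) (p : Fin 6 × Fin k),
      J.val = (finProdFinEquiv p : Fin (6 * k)).val →
      max ((groupNet (d := d) l s).forward (i + 1)
        (fun k => x (Fin.cast (groupNet (d := d) l s).width_in k)) J) 0 =
      s ^ (i + 1) * runLayers (l.take i) (inputState k (x ⟨0, hd⟩)) p.1 p.2 := by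
  intro i
  induction i with
  | zero =>
    intro _ J p hJ
    have h1 : (groupNet (d := d) l s).forward (0 + 1)
        (fun k => x (Fin.cast (groupNet (d := d) l s).width_in k)) J =
        s * (inputWeight p.1 * x ⟨0, hd⟩ + inputBias p.1) := by
      simp only [ReLUNet.forward, ReLUNet.layer, if_true]
      have hA : ∀ K, (groupNet (d := d) l s).A 0 J K =
          if K.val = 0 then s * inputWeight p.1 else 0 := by
        intro K
        rw [groupNet_A_zero, hJ, natWeight_apply]
      have hb : (groupNet (d := d) l s).b 0 J = s * inputBias p.1 := by
        rw [groupNet_b_zero, hJ, natWeight_apply]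
      rw [hb, Finset.sum_eq_single (⟨0, hd⟩ : Fin ((groupNet (d := d) l s).width 0))]
      · rw [hA, if_pos rfl]
        rw [mul_add, mul_assoc]
        rfl
      · intro K _ hK
        rw [hA, if_neg, zero_mul]
        intro h
        exact hK (Fin.ext h)
      · intro h
        exact absurd (Finset.mem_univ _) h
    rw [h1, List.take_zero, runLayers_nil, inputState, zero_add, pow_one,
      mul_max_of_nonneg _ _ hs, mul_zero]
  | succ i ih =>
    intro hi J p hJ
    have hw : (groupNet (d := d) l s).width (i + 1) = 6 * k := by
      simp only [groupNet, Nat.succ_ne_zero, if_false]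
      rw [if_pos (by omega)]
    have hi' : i < l.length := by omega
    have h1 : (groupNet (d := d) l s).forward (i + 1 + 1)
        (fun k => x (Fin.cast (groupNet (d := d) l s).width_in k)) J =
        s ^ (i + 1 + 1) * ∑ b, ∑ j, l[i] p.1 b p.2 j *
          runLayers (l.take i) (inputState k (x ⟨0, hd⟩)) b j := by
      rw [ReLUNet.forward]
      simp only [ReLUNet.layer]
      rw [groupNet_b_succ, add_zero, sum_fin_eq_sum_prod hw, Finset.mul_sum]
      refine Finset.sum_congr rfl fun b _ => ?_
      rw [Finset.mul_sum]
      refine Finset.sum_congr rfl fun j _ => ?_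
      rw [if_neg (Nat.succ_ne_zero i), ih (by omega) _ (b, j) rfl]
      have hA : (groupNet (d := d) l s).A (i + 1) J
          (Fin.cast hw.symm (finProdFinEquiv (b, j))) = s * l[i] p.1 b p.2 j := by
        rw [groupNet_A_succ l s hi', hJ, Fin.val_cast, natWeight_apply]
      rw [hA, pow_succ s (i + 1)]
      ring
    rw [h1, List.take_succ_eq_append_getElem hi', runLayers_append, runLayers_cons, runLayers_nil,
      layerStep, mul_max_of_nonneg _ _ (pow_nonneg hs _), mul_zero]

theorem realization_groupNet {d k : ℕ} (hd : 0 < d) (l : List (GroupLayer k)) {s : ℝ}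
    (hs : 0 ≤ s) (x : Fin d → ℝ) :
    (groupNet (d := d) l s).realization x = s ^ (l.length + 2) * readout l (x ⟨0, hd⟩) := by
  have hw : (groupNet (d := d) l s).width (l.length + 1) = 6 * k := by
    simp only [groupNet, Nat.succ_ne_zero, if_false, le_refl, if_true]
  have h1 : ∀ J : Fin ((groupNet (d := d) l s).width (l.length + 1 + 1)),
      (groupNet (d := d) l s).forward (l.length + 1 + 1)
        (fun k => x (Fin.cast (groupNet (d := d) l s).width_in k)) J =
        s ^ (l.length + 2) * readout l (x ⟨0, hd⟩) := by
    intro J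
    rw [ReLUNet.forward]
    simp only [ReLUNet.layer]
    rw [groupNet_b_succ, add_zero, sum_fin_eq_sum_prod hw, Finset.sum_eq_single 0]
    · rw [readout, Finset.mul_sum]
      refine Finset.sum_congr rfl fun j _ => ?_
      rw [if_neg (Nat.succ_ne_zero _), max_forward_groupNet hd l hs x _ le_rfl _ (0, j) rfl]
      have hA : (groupNet (d := d) l s).A (l.length + 1) J
            (Fin.cast hw.symm (finProdFinEquiv (0, j))) = s := by
        rw [groupNet_A_length, Fin.val_cast, natWeight_apply, if_pos rfl, mul_one]
      rw [hA, List.take_length]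
      ring
    · intro a _ ha
      refine Finset.sum_eq_zero fun j _ => ?_
      have hA : (groupNet (d := d) l s).A (l.length + 1) J
            (Fin.cast hw.symm (finProdFinEquiv (a, j))) = 0 := by
        rw [groupNet_A_length, Fin.val_cast, natWeight_apply, if_neg ha, mul_zero]
      rw [hA, zero_mul]
    · intro h
      exact absurd (Finset.mem_univ _) h
  exact h1 _

theorem readout_mem_RclassQ {d W L a b k : ℕ} (hd : 0 < d) (hdW : d ≤ W) (hkW : 6 * k ≤ W)
    (l : List (GroupLayer k)) (hL : l.length + 2 ≤ L) {s : ℝ} (hs : 0 ≤ s)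
    (hsQ : s ∈ Qset a b) (hl : ∀ M ∈ l, ∀ a' b' i j, s * M a' b' i j ∈ Qset a b) :
    (fun x : Fin d → ℝ => s ^ (l.length + 2) * readout l (x ⟨0, hd⟩)) ∈ RclassQ d W L a b := by
  have h0 := zero_mem_Qset a b
  refine ⟨groupNet l s, ?_, hL, ?_, funext fun x => realization_groupNet hd l hs x⟩
  · intro i _
    simp only [groupNet]
    split_ifs <;> omega
  · intro i hi
    rcases i with _ | i
    · refine ⟨fun J K => ?_, fun J => ?_⟩
      · rw [groupNet_A_zero]
        split_ifs
        · refine natWeight_mem h0 (fun p _ => ?_) _ _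
          rcases p with ⟨p, _⟩
          fin_cases p <;> simpa [inputWeight]
        · exact h0
      · rw [groupNet_b_zero]
        refine natWeight_mem h0 (fun p _ => ?_) _ _
        rcases p with ⟨p, _⟩
        fin_cases p <;> simpa [inputBias]
    · refine ⟨fun J K => ?_, fun J => ?_⟩
      · rcases Nat.lt_or_ge i l.length with h | h
        · rw [groupNet_A_succ l s h]
          exact natWeight_mem h0 (fun p q => hl _ (List.getElem_mem h) _ _ _ _) _ _
        · obtain rfl : i = l.length := by
            change i + 1 < l.length + 2 at hi
            omega
          rw [groupNet_A_length]
          refine natWeight_mem h0 (fun p _ => ?_) _ _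
          split_ifs <;> simpa
      · rw [groupNet_b_succ]
        exact h0

/-- Identity block. -/
def idBlock (k : ℕ) : Fin k → Fin k → ℝ := fun i j => if i = j then 1 else 0

/-- Strictly lower triangular block of ones. -/
def lowerBlock (k : ℕ) : Fin k → Fin k → ℝ := fun i j => if j < i then 1 else 0

theorem sum_idBlock_mul {k : ℕ} (i : Fin k) (v : Fin k → ℝ) :
    ∑ j, idBlock k i j * v j = v i := by
  simp [idBlock]

theorem sum_lowerBlock {k : ℕ} (i : Fin k) : ∑ j, lowerBlock k i j = i := by
  have h : Finset.univ.filter (· < i) = Finset.Iio i := by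
    ext j
    simp
  simp [lowerBlock, h]

theorem sum_idBlock {k : ℕ} (i : Fin k) : ∑ j, idBlock k i j = 1 := by
  simp [idBlock]

/-- Layer multiplying the sum of the first group and passing the other constants. -/
def sumLayer (k : ℕ) : GroupLayer k :=
  ![![1, 0, 0, 0, 0, 0], ![0, idBlock k, 0, 0, 0, 0], ![0, 0, idBlock k, 0, 0, 0],
    ![0, 0, 0, idBlock k, 0, 0], 0, 0]

/-- Layer multiplying the first two constants by `k`. -/
def scaleLayer (k : ℕ) : GroupLayer k :=
  ![![1, 0, 0, 0, 0, 0], ![0, 1, 0, 0, 0, 0], ![0, 0, idBlock k, 0, 0, 0],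
    ![0, 0, 0, idBlock k, 0, 0], 0, 0]

/-- Layer multiplying the first two constants by `k` and keeping a copy of the second one. -/
def scaleCopyLayer (k : ℕ) : GroupLayer k :=
  ![![1, 0, 0, 0, 0, 0], ![0, 1, 0, 0, 0, 0], ![0, idBlock k, 0, 0, 0, 0],
    ![0, 0, 0, idBlock k, 0, 0], 0, 0]

/-- First layer of the digit extraction. -/
def digitLayerOne (k : ℕ) : GroupLayer k :=
  ![![1, -lowerBlock k, 0, 0, 0, 0], ![2, -(2 • lowerBlock k + idBlock k), 0, 0, 0, 0],
    ![0, 0, idBlock k, 0, 0, 0], ![0, 0, 0, idBlock k, 0, 0], 0, 0]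

/-- Second layer of the digit extraction. -/
def digitLayerTwo (k : ℕ) : GroupLayer k :=
  ![![idBlock k, -idBlock k, 0, 0, 0, 0], ![0, 0, idBlock k, 0, 0, 0],
    ![0, idBlock k, 0, 0, 0, 0], ![0, 0, 0, idBlock k, 0, 0], 0, 0]

/-- Layer preparing the evaluation of the encoded matrices. -/
def gateLayer (k : ℕ) : GroupLayer k :=
  ![![0, 0, -idBlock k, idBlock k, 0, 0], ![0, idBlock k, 0, 0, 0, 0], 0,
    ![0, 0, 0, idBlock k, 0, 0], ![1, 0, 0, 0, 0, 0], 0]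

/-- Layer evaluating one encoded matrix. -/
def matrixLayer {k : ℕ} (B : Fin k → Fin k → ℝ) : GroupLayer k :=
  ![![idBlock k, 0, 0, 0, 0, 0], ![0, idBlock k, 0, 0, 0, 0],
    ![B, -idBlock k, 0, 0, -idBlock k, 0], ![0, 0, 0, idBlock k, 0, 0],
    ![0, 0, 0, -1, idBlock k, 0], ![0, 0, idBlock k, 0, 0, idBlock k]]

/-- Layer summing up all contributions. -/
def collectLayer (k : ℕ) : GroupLayer k := ![![0, 0, 1, 0, 0, 1], 0, 0, 0, 0, 0]

/-- State consisting of four constant groups. -/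
def constState (k : ℕ) (X C D e : ℝ) : GroupState k :=
  ![fun _ => X, fun _ => C, fun _ => D, fun _ => e, 0, 0]

theorem layerStep_scaleLayer {k : ℕ} {X C D e : ℝ} (hX : 0 ≤ X) (hC : 0 ≤ C) (hD : 0 ≤ D)
    (he : 0 ≤ e) :
    layerStep (scaleLayer k) (constState k X C D e) =
      constState k (k * X) (k * C) D e := by
  have hkX : 0 ≤ k * X := by positivity
  have hkC : 0 ≤ k * C := by positivity
  funext a i
  fin_cases a <;> simp [constState, layerStep, scaleLayer, Fin.sum_univ_six, sum_idBlock_mul, *]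

theorem layerStep_scaleCopyLayer {k : ℕ} {X C D e : ℝ} (hX : 0 ≤ X) (hC : 0 ≤ C)
    (he : 0 ≤ e) :
    layerStep (scaleCopyLayer k) (constState k X C D e) =
      constState k (k * X) (k * C) C e := by
  have hkX : 0 ≤ k * X := by positivity
  have hkC : 0 ≤ k * C := by positivity
  funext a i
  fin_cases a <;> simp [constState, layerStep, scaleCopyLayer, Fin.sum_univ_six, sum_idBlock_mul, *]

theorem runLayers_replicate_scaleLayer {k : ℕ} (r : ℕ) {X C D e : ℝ} (hX : 0 ≤ X) (hC : 0 ≤ C)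
    (hD : 0 ≤ D) (he : 0 ≤ e) :
    runLayers (List.replicate r (scaleLayer k))
        (constState k X C D e) =
      constState k (k ^ r * X) (k ^ r * C) D e := by
  induction r with
  | zero => simp [runLayers_nil]
  | succ r ih =>
    rw [List.replicate_succ', runLayers_append, ih, runLayers_cons, runLayers_nil,
      layerStep_scaleLayer (by positivity) (by positivity) hD he]
    simp only [pow_succ', mul_assoc]

/-- Layers producing the constants used in the digit extraction. -/
def scalingLayers (k r : ℕ) : List (GroupLayer k) :=
  List.replicate r (scaleLayer k) ++ [scaleCopyLayer k, scaleLayer k]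

theorem runLayers_scalingLayers {k : ℕ} (r : ℕ) {x : ℝ} (hx : 0 ≤ x) :
    runLayers (scalingLayers k r) (inputState k x) =
      constState k (k ^ (r + 2) * x) (k ^ (r + 2)) (k ^ r) 1 := by
  have h : inputState k x = constState k x 1 1 1 := by
    funext a i
    fin_cases a <;> simp [inputState, inputWeight, inputBias, constState, hx]
  rw [scalingLayers, runLayers_append, h,
    runLayers_replicate_scaleLayer r hx zero_le_one zero_le_one zero_le_one,
    runLayers_cons, runLayers_cons, runLayers_nil,
    layerStep_scaleCopyLayer (by positivity) (by positivity) zero_le_one,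
    layerStep_scaleLayer (by positivity) (by positivity) (by positivity) zero_le_one]
  simp only [mul_one, pow_succ', mul_assoc]

/-- Residual after extracting the leading digit `z`, located at position `z`. -/
def spike {k : ℕ} (z : Fin k) (R : ℝ) : Fin k → ℝ := fun i => if i = z then R else 0

/-- Values produced at the positions below the leading digit `z`. -/
def staircase {k : ℕ} (z : Fin k) (C R : ℝ) : Fin k → ℝ :=
  fun i => if z ≤ i then 0 else (2 * ((z : ℝ) - i) - 1) * C + 2 * R

theorem sum_spike {k : ℕ} (z : Fin k) (R : ℝ) : ∑ i, spike z R i = R := by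
  simp [spike]

theorem staircase_of_le {k : ℕ} {z i : Fin k} (h : z ≤ i) (C R : ℝ) : staircase z C R i = 0 :=
  if_pos h

theorem le_staircase_of_lt {k : ℕ} {z i : Fin k} (h : i < z) {C R : ℝ} (hC : 0 ≤ C)
    (hR : 0 ≤ R) : C ≤ staircase z C R i := by
  rw [staircase, if_neg (not_le.2 h)]
  have : (i : ℝ) + 1 ≤ z := by exact_mod_cast h
  nlinarith

theorem staircase_nonneg {k : ℕ} (z i : Fin k) {C R : ℝ} (hC : 0 ≤ C) (hR : 0 ≤ R) :
    0 ≤ staircase z C R i := by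
  rcases le_or_gt z i with h | h
  · rw [staircase_of_le h]
  · exact hC.trans (le_staircase_of_lt h hC hR)

theorem layerStep_digitLayers {k : ℕ} {y v w : Fin k → ℝ} {C R : ℝ} (z : Fin k)
    (hy : ∑ j, y j = z * C + R) (hR : 0 ≤ R) (hRC : 2 * R ≤ C) (hv : ∀ i, 0 ≤ v i)
    (hw : ∀ i, 0 ≤ w i) :
    layerStep (digitLayerTwo k) (layerStep (digitLayerOne k) ![y, fun _ => C, v, w, 0, 0]) =
      ![spike z R, v, staircase z C R, w, 0, 0] := by
  have hC : 0 ≤ C := by linarith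
  have h1 : layerStep (digitLayerOne k) ![y, fun _ => C, v, w, 0, 0] =
      ![fun i : Fin k => max (((z : ℝ) - i) * C + R) 0, staircase z C R, v, w, 0, 0] := by
    funext a i
    fin_cases a
    · simp only [layerStep, digitLayerOne, Fin.sum_univ_six]
      simp [hy, ← Finset.sum_mul, sum_lowerBlock]
      congr 1
      ring
    · simp only [layerStep, digitLayerOne, Fin.sum_univ_six]
      have h2 : ∑ j, (2 * lowerBlock k i j + idBlock k i j) * C = (2 * i + 1) * C := by
        rw [← Finset.sum_mul, Finset.sum_add_distrib, ← Finset.mul_sum, sum_lowerBlock]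
        simp [idBlock]
      have h3 : ∑ j, (-idBlock k i j + -(2 * lowerBlock k i j)) * C = -((2 * i + 1) * C) := by
        rw [← h2, ← Finset.sum_neg_distrib]
        exact Finset.sum_congr rfl fun j _ => by ring
      simp [h3, ← Finset.mul_sum, hy]
      rw [staircase]
      split_ifs with h
      · have : (z : ℝ) ≤ i := by exact_mod_cast h
        rw [max_eq_right]
        nlinarith
      · have : (i : ℝ) + 1 ≤ z := by exact_mod_cast not_le.1 h
        rw [max_eq_left]
        · ring
        · nlinarith
    all_goals simp [layerStep, digitLayerOne, Fin.sum_univ_six, sum_idBlock_mul, hv, hw]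
  have hp := fun i => staircase_nonneg z i hC hR
  rw [h1]
  funext a i
  fin_cases a
  · simp [layerStep, digitLayerTwo, Fin.sum_univ_six, sum_idBlock_mul]
    rcases lt_trichotomy i z with h | rfl | h
    · rw [spike, if_neg h.ne, staircase, if_neg (not_le.2 h)]
      have : (i : ℝ) + 1 ≤ z := by exact_mod_cast h
      have h2 : 0 ≤ ((z : ℝ) - i) * C + R := by nlinarith
      rw [max_eq_left h2, max_eq_right]
      nlinarith
    · rw [spike, if_pos rfl, staircase_of_le le_rfl]
      simp [hR]
    · rw [spike, if_neg h.ne', staircase_of_le h.le]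
      have : (z : ℝ) + 1 ≤ i := by exact_mod_cast h
      have h2 : ((z : ℝ) - i) * C + R ≤ 0 := by nlinarith
      rw [max_eq_right h2]
      simp
  all_goals simp [layerStep, digitLayerTwo, Fin.sum_univ_six, sum_idBlock_mul, hv, hw, hp]

theorem layerStep_gateLayer {k : ℕ} {g : Fin k → ℝ} (hg : ∀ i, 0 ≤ g i) (z z' : Fin k)
    {C P R : ℝ} (hP : 0 ≤ P) (hC : 1 ≤ C) (hR : 0 ≤ R) :
    layerStep (gateLayer k) ![spike z P, g, staircase z' C R, fun _ => 1, 0, 0] =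
      ![fun j => if z' ≤ j then 1 else 0, g, 0, fun _ => 1, fun _ => P, 0] := by
  funext a i
  fin_cases a
  · simp [layerStep, gateLayer, Fin.sum_univ_six, sum_idBlock_mul, sum_idBlock]
    split_ifs with h
    · simp [staircase_of_le h]
    · have := le_staircase_of_lt (not_le.1 h) (zero_le_one.trans hC) hR
      rw [max_eq_right]
      linarith
  all_goals simp [layerStep, gateLayer, Fin.sum_univ_six, sum_idBlock_mul,
    sum_idBlock, sum_spike, hg, hP]

/-- Sum of the entries in the rows from `z` and columns from `z'` on. -/
def cornerSum {k : ℕ} (B : Fin k → Fin k → ℝ) (z z' : Fin k) : ℝ :=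
  ∑ i, if z ≤ i then ∑ j, B i j * (if z' ≤ j then 1 else 0) else 0

/-- Layers evaluating the first `n` encoded matrices. -/
def matrixLayers {k : ℕ} (B : ℕ → Fin k → Fin k → ℝ) (n : ℕ) : List (GroupLayer k) :=
  (List.range n).map fun t => matrixLayer (B t)

theorem runLayers_matrixLayers {k : ℕ} {B : ℕ → Fin k → Fin k → ℝ}
    (hB0 : ∀ t i j, 0 ≤ B t i j) (hB1 : ∀ t i j, B t i j ≤ 1) (z z' : Fin k) (τ : ℕ) {C R : ℝ}
    (hC : k ≤ C) (hR : 0 ≤ R) (n : ℕ) :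
    ∃ S c : Fin k → ℝ, (∀ i, 0 ≤ S i) ∧ (∀ i, 0 ≤ c i) ∧
      runLayers (matrixLayers B n)
        ![fun j => if z' ≤ j then 1 else 0, staircase z C R, 0, fun _ => 1,
          fun _ => (k : ℝ) * τ, 0] =
        ![fun j => if z' ≤ j then 1 else 0, staircase z C R, c, fun _ => 1,
          fun _ => (k : ℝ) * ((τ - n : ℕ) : ℝ), S] ∧
      ∀ i, S i + c i = ∑ t ∈ Finset.range n,
        if τ ≤ t then if z ≤ i then ∑ j, B t i j * (if z' ≤ j then 1 else 0) else 0 else 0 := by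
  have hC0 : 0 ≤ C := (Nat.cast_nonneg k).trans hC
  induction n with
  | zero =>
    exact ⟨0, 0, fun _ => le_rfl, fun _ => le_rfl, by simp [matrixLayers, runLayers_nil], by simp⟩
  | succ n ih =>
    obtain ⟨S, c, hS, hc, hrun, hsum⟩ := ih
    have hg := fun i => staircase_nonneg z i hC0 hR
    have hrow0 : ∀ i, 0 ≤ ∑ j, B n i j * (if z' ≤ j then (1 : ℝ) else 0) := fun i =>
      Finset.sum_nonneg fun j _ => mul_nonneg (hB0 n i j) (by split_ifs <;> norm_num)
    have hrow1 : ∀ i, ∑ j, B n i j * (if z' ≤ j then (1 : ℝ) else 0) ≤ k := by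
      intro i
      refine (Finset.sum_le_sum (g := fun _ => (1 : ℝ)) fun j _ => ?_).trans (by simp)
      have := hB1 n i j
      have := hB0 n i j
      split_ifs <;> linarith
    have hτ : max ((k : ℝ) * ((τ - n : ℕ) : ℝ) - k) 0 = k * ((τ - (n + 1) : ℕ) : ℝ) := by
      rcases Nat.lt_or_ge n τ with h | h
      · obtain ⟨m, rfl⟩ := Nat.exists_eq_add_of_lt h
        rw [show n + m + 1 - n = m + 1 by omega, show n + m + 1 - (n + 1) = m by omega,
          Nat.cast_succ, mul_add, mul_one, add_sub_cancel_right, max_eq_left (by positivity)]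
      · rw [Nat.sub_eq_zero_of_le h, Nat.sub_eq_zero_of_le (by omega : τ ≤ n + 1)]
        simp
    refine ⟨fun i => S i + c i, fun i => if τ ≤ n then if z ≤ i then
      ∑ j, B n i j * (if z' ≤ j then 1 else 0) else 0 else 0, fun i => add_nonneg (hS i) (hc i),
      fun i => ?_, ?_, fun i => ?_⟩
    · dsimp only
      split_ifs
      · exact hrow0 i
      · exact le_rfl
      · exact le_rfl
    · have hl : matrixLayers B (n + 1) = matrixLayers B n ++ [matrixLayer (B n)] := by
        simp [matrixLayers, List.range_succ]
      rw [hl, runLayers_append, hrun, runLayers_cons, runLayers_nil]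
      funext a i
      fin_cases a
      · have hs := sum_idBlock_mul i fun j => if z' ≤ j then (1 : ℝ) else 0
        simp only [mul_ite, mul_one, mul_zero] at hs
        simp [layerStep, matrixLayer, Fin.sum_univ_six, hs]
        split_ifs <;> norm_num
      · simp [layerStep, matrixLayer, Fin.sum_univ_six, sum_idBlock_mul, hg]
      · have h1 : layerStep (matrixLayer (B n)) ![fun j => if z' ≤ j then 1 else 0,
            staircase z C R, c, fun _ => 1, fun _ => (k : ℝ) * ((τ - n : ℕ) : ℝ), S] 2 i =
            max (∑ j, B n i j * (if z' ≤ j then 1 else 0) - staircase z C R i -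
              k * ((τ - n : ℕ) : ℝ)) 0 := by
          simp only [layerStep, matrixLayer, Fin.sum_univ_six, Matrix.cons_val, Pi.neg_apply,
            neg_mul, Finset.sum_neg_distrib, sum_idBlock_mul, Pi.zero_apply, zero_mul,
            Finset.sum_const_zero]
          congr 1
          ring
        refine h1.trans ?_
        have h0 := hrow0 i
        have h2 := hrow1 i
        have hk0 : (0 : ℝ) ≤ k := Nat.cast_nonneg k
        have hτ0 : (0 : ℝ) ≤ k * ((τ - n : ℕ) : ℝ) := by positivity
        change _ = if τ ≤ n then if z ≤ i then _ else 0 else 0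
        split_ifs with h h'
        · rw [staircase_of_le h', Nat.sub_eq_zero_of_le h]
          rw [sub_zero, Nat.cast_zero, mul_zero, sub_zero, max_eq_left h0]
        · have := le_staircase_of_lt (not_le.1 h') hC0 hR
          rw [max_eq_right]
          linarith
        · have h3 : (1 : ℝ) ≤ ((τ - n : ℕ) : ℝ) := by
            have : 1 ≤ τ - n := by omega
            exact_mod_cast this
          have h4 := hg i
          rw [max_eq_right]
          nlinarith
      · simp [layerStep, matrixLayer, Fin.sum_univ_six, sum_idBlock]
      · have h1 : layerStep (matrixLayer (B n)) ![fun j => if z' ≤ j then 1 else 0,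
            staircase z C R, c, fun _ => 1, fun _ => (k : ℝ) * ((τ - n : ℕ) : ℝ), S] 4 i =
            max (k * ((τ - n : ℕ) : ℝ) - k) 0 := by
          simp [layerStep, matrixLayer, Fin.sum_univ_six, sum_idBlock_mul]
          congr 1
          ring
        refine h1.trans ?_
        exact hτ
      · simp [layerStep, matrixLayer, Fin.sum_univ_six, sum_idBlock_mul, hS, hc, add_comm,
          add_nonneg]
    · rw [Finset.sum_range_succ, ← hsum i]

/-- Layers realizing the evaluation of the sum of corners of the encoded matrices. -/
def coreLayers {k : ℕ} (B : ℕ → Fin k → Fin k → ℝ) (r n : ℕ) : List (GroupLayer k) :=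
  scalingLayers k r ++ [digitLayerOne k, digitLayerTwo k, digitLayerOne k, digitLayerTwo k,
    gateLayer k] ++ matrixLayers B n ++ [collectLayer k]

theorem length_coreLayers {k : ℕ} (B : ℕ → Fin k → Fin k → ℝ) (r n : ℕ) :
    (coreLayers B r n).length = r + n + 8 := by
  simp [coreLayers, scalingLayers, matrixLayers]
  omega

/-- Point encoding a row, a column and a matrix. -/
def codePoint {k : ℕ} (r : ℕ) (z z' : Fin k) (τ : ℕ) : ℝ :=
  (z * (k : ℝ) ^ (r + 2) + z' * (k : ℝ) ^ r + k * τ) / (k : ℝ) ^ (r + 3)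

theorem readout_coreLayers {k : ℕ} (hk : 3 ≤ k) {B : ℕ → Fin k → Fin k → ℝ}
    (hB0 : ∀ t i j, 0 ≤ B t i j) (hB1 : ∀ t i j, B t i j ≤ 1) {r n : ℕ} (hr : 2 * (k * n) ≤ k ^ r)
    (z z' : Fin k) {τ : ℕ} (hτ : τ < n) :
    readout (coreLayers B r n) (codePoint r z z' τ) =
      k * ∑ t ∈ Finset.range n, if τ ≤ t then cornerSum (B t) z z' else 0 := by
  have hk0 : (0 : ℝ) < k := by
    have : 0 < k := by omega
    exact_mod_cast this
  have hk3 : (3 : ℝ) ≤ k := by exact_mod_cast hk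
  have hr' : 2 * ((k : ℝ) * τ) ≤ (k : ℝ) ^ r := by
    have h : 2 * (k * τ) ≤ k ^ r :=
      (Nat.mul_le_mul_left _ (Nat.mul_le_mul_left _ hτ.le)).trans hr
    exact_mod_cast h
  have hkr : (1 : ℝ) ≤ (k : ℝ) ^ r := one_le_pow₀ (by linarith)
  have hP : 0 ≤ (k : ℝ) * τ := by positivity
  have hR1 : 0 ≤ z' * (k : ℝ) ^ r + k * τ := by positivity
  have hz' : (z' : ℝ) + 1 ≤ k := by exact_mod_cast z'.2
  have hR2 : 2 * (z' * (k : ℝ) ^ r + k * τ) ≤ (k : ℝ) ^ (r + 2) := by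
    rw [pow_add]
    have h1 : (2 * (z' : ℝ) + 1) * (k : ℝ) ^ r ≤ (k : ℝ) ^ 2 * (k : ℝ) ^ r :=
      mul_le_mul_of_nonneg_right (by nlinarith) (by positivity)
    nlinarith
  have hkC : (k : ℝ) ≤ (k : ℝ) ^ (r + 2) := by
    rw [pow_add]
    nlinarith
  have hx : 0 ≤ codePoint r z z' τ := by
    rw [codePoint]
    positivity
  have hy : ∑ _j : Fin k, (k : ℝ) ^ (r + 2) * codePoint r z z' τ =
      z * (k : ℝ) ^ (r + 2) + (z' * (k : ℝ) ^ r + k * τ) := by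
    rw [Finset.sum_const, Finset.card_univ, Fintype.card_fin, nsmul_eq_mul, codePoint]
    field_simp
    ring
  obtain ⟨S, c, hS, hc, hrun, hsum⟩ := runLayers_matrixLayers hB0 hB1 z z' τ hkC hR1 n
  have hcollect : ∀ i, layerStep (collectLayer k) ![fun j => if z' ≤ j then 1 else 0,
      staircase z ((k : ℝ) ^ (r + 2)) (z' * (k : ℝ) ^ r + k * τ), c, fun _ => 1,
      fun _ => (k : ℝ) * ((τ - n : ℕ) : ℝ), S] 0 i = ∑ i, (S i + c i) := by
    intro i
    have h1 : 0 ≤ ∑ i, (S i + c i) := Finset.sum_nonneg fun i _ => add_nonneg (hS i) (hc i)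
    rw [← max_eq_left h1]
    simp [layerStep, collectLayer, Fin.sum_univ_six, Finset.sum_add_distrib, add_comm]
  rw [readout, coreLayers]
  simp only [runLayers_append, runLayers_cons, runLayers_nil]
  rw [runLayers_scalingLayers r hx, constState,
    layerStep_digitLayers z hy hR1 hR2 (fun _ => by positivity) (fun _ => zero_le_one),
    layerStep_digitLayers z' (sum_spike z _) hP hr'
      (fun i => staircase_nonneg z i (by positivity) hR1) (fun _ => zero_le_one),
    layerStep_gateLayer (fun i => staircase_nonneg z i (by positivity) hR1) z' z' hP hkr hP, hrun]
  simp only [hcollect, hsum]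
  rw [Finset.sum_const, Finset.card_univ, Fintype.card_fin, nsmul_eq_mul, Finset.sum_comm]
  congr 1
  refine Finset.sum_congr rfl fun t _ => ?_
  split_ifs
  · rfl
  · simp

theorem codePoint_mem_Icc {k : ℕ} (hk : 0 < k) {r n : ℕ} (hr : 2 * (k * n) ≤ k ^ r)
    (z z' : Fin k) {τ : ℕ} (hτ : τ < n) : codePoint r z z' τ ∈ Set.Icc (0 : ℝ) 1 := by
  have hk0 : (0 : ℝ) < k := by exact_mod_cast hk
  have hr' : 2 * ((k : ℝ) * τ) ≤ (k : ℝ) ^ r := by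
    have h : 2 * (k * τ) ≤ k ^ r :=
      (Nat.mul_le_mul_left _ (Nat.mul_le_mul_left _ hτ.le)).trans hr
    exact_mod_cast h
  have hz : (z : ℝ) + 1 ≤ k := by exact_mod_cast z.2
  have hz' : (z' : ℝ) + 1 ≤ k := by exact_mod_cast z'.2
  have hk1 : (1 : ℝ) ≤ k := by exact_mod_cast hk
  have hkr : (0 : ℝ) < (k : ℝ) ^ r := by positivity
  have hP : 0 ≤ (k : ℝ) * τ := by positivity
  rw [codePoint]
  refine ⟨by positivity, div_le_one_of_le₀ ?_ (by positivity)⟩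
  have h1 : ((z : ℝ) + 1) * (k : ℝ) ^ (r + 2) ≤ (k : ℝ) ^ (r + 3) := by
    rw [pow_succ' _ (r + 2)]
    exact mul_le_mul_of_nonneg_right hz (by positivity)
  have h2 : ((z' : ℝ) + 1) * (k : ℝ) ^ r ≤ (k : ℝ) ^ (r + 2) := by
    rw [pow_add, mul_comm ((k : ℝ) ^ r)]
    exact mul_le_mul_of_nonneg_right (by nlinarith) hkr.le
  nlinarith

theorem readout_append_replicate_sumLayer {k : ℕ} (l : List (GroupLayer k)) (q : ℕ) (x : ℝ) :
    readout (l ++ List.replicate q (sumLayer k)) x = k ^ q * readout l x := by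
  induction q with
  | zero => simp
  | succ q ih =>
    rw [List.replicate_succ', ← List.append_assoc, pow_succ', mul_assoc, ← ih]
    have h := runLayers_inputState_nonneg (l ++ List.replicate q (sumLayer k)) x 0
    simp only [readout]
    rw [runLayers_append _ [sumLayer k], runLayers_cons, runLayers_nil]
    have h1 : ∀ i, layerStep (sumLayer k)
        (runLayers (l ++ List.replicate q (sumLayer k)) (inputState k x)) 0 i =
        ∑ j, runLayers (l ++ List.replicate q (sumLayer k)) (inputState k x) 0 j := by
      intro i
      rw [← max_eq_left (Finset.sum_nonneg fun i _ => h i)]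
      simp [layerStep, sumLayer, Fin.sum_univ_six]
    simp only [h1]
    simp

/-- Blocks whose entries are bounded by `2` and are multiples of `2 ^ (-m)`. -/
def IsDyadicBlock {k : ℕ} (m : ℕ) (M : Fin k → Fin k → ℝ) : Prop :=
  ∀ i j, |M i j| ≤ 2 ∧ ∃ z : ℤ, M i j * 2 ^ m = z

theorem isDyadicBlock_of_int {k : ℕ} (m : ℕ) {M : Fin k → Fin k → ℝ}
    (h : ∀ i j, ∃ z : ℤ, |z| ≤ 2 ∧ M i j = z) : IsDyadicBlock m M := by
  intro i j
  obtain ⟨z, hz, hM⟩ := h i j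
  refine ⟨?_, z * 2 ^ m, by rw [hM]; push_cast; ring⟩
  rw [hM]
  exact_mod_cast hz

theorem isDyadicBlock_zero {k : ℕ} (m : ℕ) : IsDyadicBlock m (0 : Fin k → Fin k → ℝ) :=
  isDyadicBlock_of_int m fun _ _ => ⟨0, by norm_num, by simp⟩

theorem isDyadicBlock_one {k : ℕ} (m : ℕ) : IsDyadicBlock m (1 : Fin k → Fin k → ℝ) :=
  isDyadicBlock_of_int m fun _ _ => ⟨1, by norm_num, by simp⟩

theorem isDyadicBlock_two {k : ℕ} (m : ℕ) : IsDyadicBlock m (2 : Fin k → Fin k → ℝ) :=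
  isDyadicBlock_of_int m fun _ _ => ⟨2, by norm_num, by simp⟩

theorem IsDyadicBlock.neg {k m : ℕ} {M : Fin k → Fin k → ℝ} (h : IsDyadicBlock m M) :
    IsDyadicBlock m (-M) := by
  intro i j
  obtain ⟨h1, z, hz⟩ := h i j
  refine ⟨by simpa using h1, -z, ?_⟩
  rw [Pi.neg_apply, Pi.neg_apply, neg_mul, hz, Int.cast_neg]

theorem isDyadicBlock_idBlock (k m : ℕ) : IsDyadicBlock m (idBlock k) := by
  refine isDyadicBlock_of_int m fun i j => ?_
  rw [idBlock]
  split_ifs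
  · exact ⟨1, by norm_num, by simp⟩
  · exact ⟨0, by norm_num, by simp⟩

theorem isDyadicBlock_lowerBlock (k m : ℕ) : IsDyadicBlock m (lowerBlock k) := by
  refine isDyadicBlock_of_int m fun i j => ?_
  rw [lowerBlock]
  split_ifs
  · exact ⟨1, by norm_num, by simp⟩
  · exact ⟨0, by norm_num, by simp⟩

theorem isDyadicBlock_two_lowerBlock_add_idBlock (k m : ℕ) :
    IsDyadicBlock m (2 • lowerBlock k + idBlock k) := by
  refine isDyadicBlock_of_int m fun i j => ?_
  simp only [Pi.add_apply, Pi.smul_apply, lowerBlock, idBlock]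
  rcases lt_trichotomy j i with h | rfl | h
  · exact ⟨2, by norm_num, by simp [h, h.ne']⟩
  · exact ⟨1, by norm_num, by simp⟩
  · exact ⟨0, by norm_num, by simp [h.le, h.ne]⟩

theorem isDyadicBlock_coreLayers {k m : ℕ} {B : ℕ → Fin k → Fin k → ℝ}
    (hB : ∀ t, IsDyadicBlock m (B t)) (r n q : ℕ) :
    ∀ M ∈ coreLayers B r n ++ List.replicate q (sumLayer k), ∀ a b, IsDyadicBlock m (M a b) := by
  have h0 := isDyadicBlock_zero (k := k) m
  have h1 := isDyadicBlock_one (k := k) m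
  have h2 := isDyadicBlock_two (k := k) m
  have h3 := isDyadicBlock_idBlock k m
  have h4 := (isDyadicBlock_lowerBlock k m).neg
  have h5 := (isDyadicBlock_two_lowerBlock_add_idBlock k m).neg
  have h6 := h3.neg
  have h7 := h1.neg
  intro M hM
  simp only [coreLayers, scalingLayers, matrixLayers, List.mem_append, List.mem_cons,
    List.not_mem_nil, or_false, List.mem_replicate, List.mem_map, List.mem_range] at hM
  rcases hM with ((((⟨_, rfl⟩ | rfl | rfl) | rfl | rfl | rfl | rfl | rfl) | ⟨t, _, rfl⟩) | rfl) |
    ⟨_, rfl⟩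
  all_goals
    intro a b
    fin_cases a <;> fin_cases b <;> first
      | exact h0 | exact h1 | exact h2 | exact h3 | exact h4 | exact h5 | exact h6 | exact h7
      | exact hB _

theorem two_pow_mul_mem_Qset {a b m : ℕ} (ha : 0 < a) (hm : m + 1 ≤ a + b) {w : ℝ}
    (hw : |w| ≤ 2) (hz : ∃ z : ℤ, w * 2 ^ m = z) : 2 ^ (a - 1) * w ∈ Qset a b := by
  obtain ⟨z, hz⟩ := hz
  obtain ⟨a, rfl⟩ : ∃ a', a = a' + 1 := ⟨a - 1, by omega⟩
  obtain ⟨c, hc⟩ : ∃ c, a + b = m + c := ⟨a + b - m, by omega⟩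
  rw [Nat.add_sub_cancel]
  refine ⟨abs_lt.1 ?_, z * 2 ^ c, ?_⟩
  · rw [abs_mul, abs_of_pos (by positivity : (0 : ℝ) < 2 ^ a), pow_succ, pow_succ]
    have : (0 : ℝ) < 2 ^ a := by positivity
    nlinarith
  · push_cast
    rw [← hz, zpow_neg, zpow_natCast, eq_mul_inv_iff_mul_eq₀ (by positivity)]
    calc (2 : ℝ) ^ a * w * 2 ^ b = w * 2 ^ (a + b) := by ring
      _ = w * 2 ^ m * 2 ^ c := by rw [hc]; ring

/-- Matrices encoding a family of `m`-bit integers. -/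
def bitMatrix {n k m : ℕ} (f : Fin n × Fin k × Fin k → Fin (2 ^ m)) (t : ℕ) (i j : Fin k) : ℝ :=
  if h : t < n then (f (⟨t, h⟩, i, j) : ℝ) / 2 ^ m else 0

theorem bitMatrix_nonneg {n k m : ℕ} (f : Fin n × Fin k × Fin k → Fin (2 ^ m)) (t : ℕ)
    (i j : Fin k) : 0 ≤ bitMatrix f t i j := by
  rw [bitMatrix]
  split_ifs
  · positivity
  · exact le_rfl

theorem bitMatrix_le_one {n k m : ℕ} (f : Fin n × Fin k × Fin k → Fin (2 ^ m)) (t : ℕ)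
    (i j : Fin k) : bitMatrix f t i j ≤ 1 := by
  rw [bitMatrix]
  split_ifs with h
  · refine div_le_one_of_le₀ ?_ (by positivity)
    exact_mod_cast (f (⟨t, h⟩, i, j)).2.le
  · exact zero_le_one

theorem isDyadicBlock_bitMatrix {n k m : ℕ} (f : Fin n × Fin k × Fin k → Fin (2 ^ m)) (t : ℕ) :
    IsDyadicBlock m (bitMatrix f t) := by
  intro i j
  constructor
  · rw [abs_of_nonneg (bitMatrix_nonneg f t i j)]
    exact (bitMatrix_le_one f t i j).trans one_le_two
  · rw [bitMatrix]
    split_ifs with h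
    · refine ⟨(f (⟨t, h⟩, i, j) : ℕ), ?_⟩
      rw [div_mul_cancel₀ _ (by positivity)]
      rfl
    · exact ⟨0, by simp⟩

theorem sum_cornerSum_bitMatrix {n k m : ℕ} (f : Fin n × Fin k × Fin k → Fin (2 ^ m))
    (p : Fin n × Fin k × Fin k) :
    (∑ t ∈ Finset.range n, if (p.1 : ℕ) ≤ t then cornerSum (bitMatrix f t) p.2.1 p.2.2 else 0) =
      ∑ u, if p ≤ u then (f u : ℝ) / 2 ^ m else 0 := by
  rw [Finset.sum_range, Fintype.sum_prod_type]
  refine Finset.sum_congr rfl fun t _ => ?_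
  rw [Fintype.sum_prod_type, cornerSum]
  split_ifs with h
  · refine Finset.sum_congr rfl fun i _ => ?_
    split_ifs with h'
    · refine Finset.sum_congr rfl fun j _ => ?_
      have : p ≤ (t, i, j) ↔ p.2.2 ≤ j := ⟨fun h => h.2.2, fun hj => ⟨h, h', hj⟩⟩
      simp [this, bitMatrix]
    · refine (Finset.sum_eq_zero fun j _ => if_neg fun hp => h' hp.2.1).symm
  · refine (Finset.sum_eq_zero fun i _ => Finset.sum_eq_zero fun j _ => ?_).symm
    exact if_neg fun hp => h hp.1

theorem exists_sum_Ici_sub_ge {n k m : ℕ} {f g : Fin n × Fin k × Fin k → Fin (2 ^ m)}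
    (hfg : f ≠ g) : ∃ p, 1 / 2 ^ m ≤
      |(∑ u, if p ≤ u then (f u : ℝ) / 2 ^ m else 0) -
        ∑ u, if p ≤ u then (g u : ℝ) / 2 ^ m else 0| := by
  classical
  obtain ⟨u, hu⟩ := Function.ne_iff.1 hfg
  obtain ⟨p, hp⟩ := Finset.exists_maximal
    (⟨u, by simpa using hu⟩ : (Finset.univ.filter fun u => f u ≠ g u).Nonempty)
  refine ⟨p, ?_⟩
  rw [← Finset.sum_sub_distrib, Finset.sum_eq_single p]
  · have h1 : f p ≠ g p := by simpa using hp.1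
    have h2 : (1 : ℝ) ≤ |(f p : ℝ) - g p| := by
      have h3 : ((f p : ℕ) : ℤ) - (g p : ℕ) ≠ 0 := by
        intro h
        apply h1
        apply Fin.ext
        omega
      have := Int.one_le_abs h3
      exact_mod_cast this
    rw [if_pos le_rfl, if_pos le_rfl, ← sub_div, abs_div,
      abs_of_pos (by positivity : (0 : ℝ) < 2 ^ m)]
    exact div_le_div_of_nonneg_right h2 (by positivity)
  · intro v _ hv
    by_cases hpv : p ≤ v
    · have : f v = g v := by
        by_contra hne
        exact hv (le_antisymm (hp.2 (by simpa using hne) hpv) hpv)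
      simp [this]
    · simp [hpv]
  · simp

theorem exists_readout_sub_ge {n k m r : ℕ} (hk : 3 ≤ k) (hr : 2 * (k * n) ≤ k ^ r)
    {f g : Fin n × Fin k × Fin k → Fin (2 ^ m)} (hfg : f ≠ g) :
    ∃ x ∈ Set.Icc (0 : ℝ) 1, k / 2 ^ m ≤
      |readout (coreLayers (bitMatrix f) r n) x - readout (coreLayers (bitMatrix g) r n) x| := by
  obtain ⟨p, hp⟩ := exists_sum_Ici_sub_ge hfg
  refine ⟨codePoint r p.2.1 p.2.2 p.1, codePoint_mem_Icc (by omega) hr _ _ p.1.2, ?_⟩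
  rw [readout_coreLayers hk (bitMatrix_nonneg f) (bitMatrix_le_one f) hr _ _ p.1.2,
    readout_coreLayers hk (bitMatrix_nonneg g) (bitMatrix_le_one g) hr _ _ p.1.2,
    sum_cornerSum_bitMatrix, sum_cornerSum_bitMatrix, ← mul_sub, abs_mul, Nat.abs_cast]
  calc (k : ℝ) / 2 ^ m = k * (1 / 2 ^ m) := by ring
    _ ≤ _ := mul_le_mul_of_nonneg_left hp (Nat.cast_nonneg k)

theorem natCast_card_le_coveringNumber {α ι : Type*} [Fintype ι] {ε : ℝ≥0∞} {X : Set α}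
    {δ : α → α → ℝ≥0∞} (g : ι → α) (hg : ∀ i, g i ∈ X)
    (hsep : ∀ i j, i ≠ j → ∀ x ∈ X, δ (g i) x ≤ ε → ε < δ (g j) x) :
    (Fintype.card ι : ℕ∞) ≤ coveringNumber ε X δ := by
  refine le_sInf ?_
  rintro _ ⟨C, hCX, hC, rfl⟩
  choose c hc hcδ using fun i => hC (g i) (hg i)
  have hinj : Function.Injective fun i => (⟨c i, hc i⟩ : C) := by
    intro i j hij
    by_contra hne
    have hij' : c i = c j := congrArg Subtype.val hij
    have := hsep i j hne (c i) (hCX (hc i)) (hcδ i)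
    rw [hij'] at this
    exact absurd (hcδ j) (not_le.2 this)
  have := Fintype.card_le_of_injective _ hinj
  rw [Fintype.card_coe] at this
  exact_mod_cast this

theorem ReLUNet.continuous_realization {d : ℕ} (Φ : ReLUNet d) : Continuous Φ.realization := by
  have h : ∀ i, Continuous (Φ.forward i) := by
    intro i
    induction i with
    | zero => exact continuous_id
    | succ i ih =>
      refine continuous_pi fun j => ?_
      simp only [ReLUNet.forward, ReLUNet.layer]
      refine (continuous_finsetSum _ fun k _ => continuous_const.mul ?_).add continuous_const
      split_ifs
      · exact (continuous_apply k).comp ih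
      · exact ((continuous_apply k).comp ih).max continuous_const
  exact (continuous_apply _).comp ((h _).comp (continuous_pi fun k => continuous_apply _))

theorem continuous_of_mem_RclassQ {d W L a b : ℕ} {f : (Fin d → ℝ) → ℝ}
    (hf : f ∈ RclassQ d W L a b) : Continuous f := by
  obtain ⟨Φ, _, _, _, rfl⟩ := hf
  exact Φ.continuous_realization

theorem cubeDist_le_add {d : ℕ} {p : ℝ≥0∞} (hp : 1 ≤ p) {f g h : (Fin d → ℝ) → ℝ}
    (hf : Continuous f) (hg : Continuous g) (hh : Continuous h) :
    cubeDist d p f g ≤ cubeDist d p f h + cubeDist d p g h := by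
  have h1 : f - g = (f - h) - (g - h) := by
    ext x
    simp
  rw [cubeDist, h1]
  exact eLpNorm_sub_le (hf.sub hh).aestronglyMeasurable (hg.sub hh).aestronglyMeasurable hp

theorem ofReal_le_eLpNorm_coordinate {d : ℕ} (i₀ : Fin d) {p : ℝ≥0∞} (hp : 1 ≤ p) {h : ℝ → ℝ}
    {Λ γ x₀ : ℝ} (hLip : ∀ x y, |h x - h y| ≤ Λ * |x - y|) (hγ : 0 < γ) (hγΛ : γ ≤ Λ)
    (hx₀ : x₀ ∈ Set.Icc (0 : ℝ) 1) (hhx : γ ≤ |h x₀|) :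
    ENNReal.ofReal (γ ^ 2 / (4 * Λ)) ≤
      eLpNorm (fun x : Fin d → ℝ => h (x i₀)) p (volume.restrict (unitCube d)) := by
  have hΛ : 0 < Λ := hγ.trans_le hγΛ
  have hcont : Continuous h := by
    refine (LipschitzWith.of_dist_le_mul (K := ⟨Λ, hΛ.le⟩) fun x y => ?_).continuous
    exact hLip x y
  set ℓ := γ / (2 * Λ) with hℓ
  have hℓ0 : 0 < ℓ := by positivity
  have hℓ1 : ℓ ≤ 1 / 2 := by
    rw [hℓ, div_le_iff₀ (by positivity)]
    linarith
  have hΛℓ : Λ * ℓ = γ / 2 := by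
    rw [hℓ]
    field_simp
  obtain ⟨u, hu0, hu1, hu⟩ : ∃ u, 0 ≤ u ∧ u + ℓ ≤ 1 ∧
      ∀ x ∈ Set.Icc u (u + ℓ), |x - x₀| ≤ ℓ := by
    rcases le_total x₀ (1 / 2) with h | h
    · exact ⟨x₀, hx₀.1, by linarith, fun x hx => abs_le.2 ⟨by linarith [hx.1], by linarith [hx.2]⟩⟩
    · exact ⟨x₀ - ℓ, by linarith, by linarith [hx₀.2],
        fun x hx => abs_le.2 ⟨by linarith [hx.1], by linarith [hx.2]⟩⟩
  have hlow : ∀ x ∈ Set.Icc u (u + ℓ), γ / 2 ≤ |h x| := by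
    intro x hx
    have h1 := (hLip x x₀).trans (mul_le_mul_of_nonneg_left (hu x hx) hΛ.le)
    have h2 := abs_sub_abs_le_abs_sub (h x₀) (h x)
    rw [abs_sub_comm] at h2
    linarith
  set S : Set (Fin d → ℝ) :=
    Set.univ.pi fun i => if i = i₀ then Set.Icc u (u + ℓ) else Set.Icc 0 1 with hS
  have hSmeas : MeasurableSet S := by
    refine MeasurableSet.univ_pi fun i => ?_
    split_ifs
    · exact measurableSet_Icc
    · exact measurableSet_Icc
  have hSvol : volume S = ENNReal.ofReal ℓ := by
    rw [hS, volume_pi_pi, Finset.prod_eq_single i₀]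
    · simp
    · intro i _ hi
      simp [hi]
    · simp
  have hSsub : S ⊆ unitCube d := by
    intro x hx i _
    have := hx i trivial
    dsimp only at this
    split_ifs at this
    · exact ⟨hu0.trans this.1, this.2.trans hu1⟩
    · exact this
  have hSi : ∀ x ∈ S, x i₀ ∈ Set.Icc u (u + ℓ) := by
    intro x hx
    have := hx i₀ trivial
    simpa using this
  calc ENNReal.ofReal (γ ^ 2 / (4 * Λ)) = ENNReal.ofReal (γ / 2) * volume S := by
        rw [hSvol, ← ENNReal.ofReal_mul (by positivity)]
        congr 1
        rw [hℓ]
        field_simp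
        ring
    _ = ∫⁻ _ in S, ENNReal.ofReal (γ / 2) := by rw [setLIntegral_const]
    _ ≤ ∫⁻ x in S, ‖h (x i₀)‖ₑ := by
        refine setLIntegral_mono' hSmeas fun x hx => ?_
        rw [Real.enorm_eq_ofReal_abs]
        exact ENNReal.ofReal_le_ofReal (hlow _ (hSi x hx))
    _ ≤ ∫⁻ x in unitCube d, ‖h (x i₀)‖ₑ := lintegral_mono_set hSsub
    _ = eLpNorm (fun x : Fin d → ℝ => h (x i₀)) 1 (volume.restrict (unitCube d)) := by
        rw [eLpNorm_one_eq_lintegral_enorm]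
    _ ≤ _ := eLpNorm_le_eLpNorm_of_exponent_le hp
        (hcont.comp (continuous_apply i₀)).aestronglyMeasurable

theorem natCast_pow_le_coveringNumber {d W L a b k m n : ℕ} {p : ℝ≥0∞} {ε : ℝ} (hp : 1 ≤ p)
    (hd : 0 < d) (hdW : d ≤ W) (ha : 0 < a) (hk : 3 ≤ k) (hkW : 6 * k ≤ W) (hm : m + 1 ≤ a + b)
    (hnL : 2 * n + 12 ≤ L) (hε : 0 < ε)
    (hεσ : 2 * ε < (2 ^ (a - 1)) ^ L * (k : ℝ) ^ (L - 2 * n - 12) * k /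
      (8 * 4 ^ m * (12 * k) ^ (2 * n + 10))) :
    (((2 ^ m) ^ (n * (k * k)) : ℕ) : ℕ∞) ≤
      coveringNumber (ENNReal.ofReal ε) (RclassQ d W L a b) (cubeDist d p) := by
  have hr : 2 * (k * n) ≤ k ^ (n + 2) := by
    have h1 : n ≤ k ^ n := (Nat.lt_pow_self (by omega)).le
    calc 2 * (k * n) ≤ k * (k * k ^ n) := by gcongr; omega
      _ = k ^ (n + 2) := by ring
  have hk0 : (0 : ℝ) < k := by
    have : 0 < k := by omega
    exact_mod_cast this
  have hk1 : (1 : ℝ) ≤ 12 * k := by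
    have : (3 : ℝ) ≤ k := by exact_mod_cast hk
    linarith
  set q := L - 2 * n - 12 with hq
  set σ : ℝ := (2 ^ (a - 1)) ^ L * (k : ℝ) ^ q with hσ
  have hσ0 : 0 < σ := by positivity
  have hlen : ∀ f : Fin n × Fin k × Fin k → Fin (2 ^ m),
      (coreLayers (bitMatrix f) (n + 2) n).length = 2 * n + 10 := by
    intro f
    rw [length_coreLayers]
    ring
  set l : (Fin n × Fin k × Fin k → Fin (2 ^ m)) → List (GroupLayer k) := fun f =>
    coreLayers (bitMatrix f) (n + 2) n ++ List.replicate q (sumLayer k) with hl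
  have hllen : ∀ f, (l f).length + 2 = L := by
    intro f
    simp only [hl, List.length_append, hlen, List.length_replicate]
    omega
  have hdy : ∀ f, ∀ M ∈ l f, ∀ a' b', IsDyadicBlock m (M a' b') := fun f =>
    isDyadicBlock_coreLayers (isDyadicBlock_bitMatrix f) (n + 2) n q
  have hcore : ∀ f, ∀ M ∈ coreLayers (bitMatrix f) (n + 2) n, ∀ a' b' i j, |M a' b' i j| ≤ 2 :=
    fun f M hM a' b' i j => (hdy f M (List.mem_append_left _ hM) a' b' i j).1
  have hs : (2 : ℝ) ^ (a - 1) ∈ Qset a b := by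
    have := two_pow_mul_mem_Qset (a := a) (b := b) (w := 1) ha hm (by norm_num)
      ⟨2 ^ m, by push_cast; ring⟩
    rwa [mul_one] at this
  set F : (Fin n × Fin k × Fin k → Fin (2 ^ m)) → (Fin d → ℝ) → ℝ := fun f x =>
    ((2 : ℝ) ^ (a - 1)) ^ L * readout (l f) (x ⟨0, hd⟩) with hF
  have hFmem : ∀ f, F f ∈ RclassQ d W L a b := by
    intro f
    have := readout_mem_RclassQ hd hdW hkW (l f) (hllen f).le (by positivity) hs
      (fun M hM a' b' i j => two_pow_mul_mem_Qset ha hm (hdy f M hM a' b' i j).1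
        (hdy f M hM a' b' i j).2)
    rwa [hllen f] at this
  have hcard : (2 ^ m) ^ (n * (k * k)) = Fintype.card (Fin n × Fin k × Fin k → Fin (2 ^ m)) := by
    simp [Fintype.card_prod]
  rw [hcard]
  refine natCast_card_le_coveringNumber F hFmem fun f g hfg x hx hfx => ?_
  by_contra! hgx
  obtain ⟨x₀, hx₀, hx₀'⟩ := exists_readout_sub_ge hk hr hfg
  set u : ℝ → ℝ := readout (coreLayers (bitMatrix f) (n + 2) n)
  set v : ℝ → ℝ := readout (coreLayers (bitMatrix g) (n + 2) n)
  have hu : ∀ x y, |u x - u y| ≤ k * ((12 * k) ^ (2 * n + 10) * |x - y|) := by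
    intro x y
    have := abs_readout_sub_le (hcore f) x y
    rwa [hlen] at this
  have hv : ∀ x y, |v x - v y| ≤ k * ((12 * k) ^ (2 * n + 10) * |x - y|) := by
    intro x y
    have := abs_readout_sub_le (hcore g) x y
    rwa [hlen] at this
  have hlower := ofReal_le_eLpNorm_coordinate (⟨0, hd⟩ : Fin d) hp
    (h := fun y => σ * (u y - v y)) (γ := σ * (k / 2 ^ m))
    (Λ := σ * (2 * k * (12 * k) ^ (2 * n + 10))) (x₀ := x₀)
    (fun x y => by
      rw [← mul_sub, abs_mul, abs_of_pos hσ0, mul_assoc σ (2 * (k : ℝ) * _)]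
      refine mul_le_mul_of_nonneg_left ?_ hσ0.le
      have h1 : u x - v x - (u y - v y) = (u x - u y) - (v x - v y) := by ring
      rw [h1]
      refine (abs_sub _ _).trans ?_
      linarith [hu x y, hv x y])
    (by positivity)
    (by
      refine mul_le_mul_of_nonneg_left ?_ hσ0.le
      refine (div_le_self hk0.le (one_le_pow₀ (by norm_num))).trans ?_
      nlinarith [one_le_pow₀ (n := 2 * n + 10) hk1])
    hx₀
    (by
      rw [abs_mul, abs_of_pos hσ0]
      exact mul_le_mul_of_nonneg_left hx₀' hσ0.le)
  have hFsub : (fun x : Fin d → ℝ => σ * (u (x ⟨0, hd⟩) - v (x ⟨0, hd⟩))) = F f - F g := by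
    ext x
    simp only [hF, hl, hσ, Pi.sub_apply, readout_append_replicate_sumLayer, u, v]
    ring
  rw [hFsub] at hlower
  have htri := cubeDist_le_add hp (continuous_of_mem_RclassQ (hFmem f))
    (continuous_of_mem_RclassQ (hFmem g)) (continuous_of_mem_RclassQ hx)
  have h2 := (hlower.trans htri).trans (add_le_add hfx hgx)
  rw [← ENNReal.ofReal_add hε.le hε.le, ENNReal.ofReal_le_ofReal_iff (by positivity)] at h2
  have h3 : (σ * (k / 2 ^ m)) ^ 2 / (4 * (σ * (2 * k * (12 * k) ^ (2 * n + 10)))) =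
      σ * k / (8 * 4 ^ m * (12 * k) ^ (2 * n + 10)) := by
    have : (4 : ℝ) ^ m = 2 ^ m * 2 ^ m := by rw [← mul_pow]; norm_num
    rw [this]
    field_simp
    ring
  rw [h3] at h2
  linarith

theorem two_mul_lt_separation {W L a k m n : ℕ} {ε : ℝ} (ha : 0 < a) (hk : 256 ≤ k)
    (hWk : W + 1 ≤ 12 * k) (hL : 2000 ≤ L) (hn : 100 * n ≤ L) (hε : 0 < ε) (hε' : ε < 1 / 100)
    (hm : 2 * (m : ℝ) ≤
      2 + Real.logb 2 (((W : ℝ) + 1) ^ L * (2 : ℝ) ^ (a * L) / ε) / 4) :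
    2 * ε < (2 ^ (a - 1)) ^ L * (k : ℝ) ^ (L - 2 * n - 12) * k /
      (8 * 4 ^ m * (12 * k) ^ (2 * n + 10)) := by
  have hk' : (256 : ℝ) ≤ k := by exact_mod_cast hk
  have hk0 : (0 : ℝ) < k := by linarith
  set κ := Real.logb 2 k with hκ
  have hκ8 : 8 ≤ κ := by
    rw [hκ, Real.le_logb_iff_rpow_le (by norm_num) hk0]
    norm_num
    exact hk
  have hsq : Real.logb 2 ((k : ℝ) ^ 2) = 2 * κ := by
    rw [Real.logb_pow, Nat.cast_ofNat]
  have h12 : Real.logb 2 (12 * k) ≤ 2 * κ := by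
    rw [← hsq]
    exact Real.logb_le_logb_of_le (by norm_num) (by positivity) (by nlinarith)
  have hW1 : Real.logb 2 ((W : ℝ) + 1) ≤ 2 * κ := by
    refine le_trans ?_ h12
    exact Real.logb_le_logb_of_le (by norm_num) (by positivity) (by exact_mod_cast hWk)
  have hlε : Real.logb 2 ε ≤ 0 := Real.logb_nonpos (by norm_num) hε.le (by linarith)
  rw [logb_weight_resolution hε] at hm
  rw [← Real.logb_lt_logb_iff (b := 2) (by norm_num) (by positivity) (by positivity),
    Real.logb_div (by positivity) (by positivity), Real.logb_mul (by positivity) (by positivity),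
    Real.logb_mul (by positivity) (by positivity), Real.logb_mul (by positivity) (by positivity),
    Real.logb_mul (by positivity) (by positivity), Real.logb_mul (by positivity) (by positivity),
    Real.logb_pow, Real.logb_pow, Real.logb_pow, Real.logb_pow, Real.logb_pow]
  have h4 : Real.logb 2 4 = 2 := by
    rw [show (4 : ℝ) = 2 ^ (2 : ℝ) by norm_num, Real.logb_rpow (by norm_num) (by norm_num)]
  have h8 : Real.logb 2 8 = 3 := by
    rw [show (8 : ℝ) = 2 ^ (3 : ℝ) by norm_num, Real.logb_rpow (by norm_num) (by norm_num)]
  rw [h4, h8, Real.logb_self_eq_one (by norm_num), Nat.cast_sub ha, Nat.sub_sub,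
    Nat.cast_sub (by omega)]
  push_cast
  have ha' : (1 : ℝ) ≤ a := by exact_mod_cast ha
  have hL' : (2000 : ℝ) ≤ L := by exact_mod_cast hL
  have hn' : 100 * (n : ℝ) ≤ L := by exact_mod_cast hn
  have e1 : (L : ℝ) * Real.logb 2 ((W : ℝ) + 1) ≤ L * (2 * κ) := by gcongr
  have e2 : (2 * (n : ℝ) + 10) * Real.logb 2 (12 * k) ≤ (2 * n + 10) * (2 * κ) := by gcongr
  have e3 : 0 ≤ (κ - 8) * ((L : ℝ) / 2 - 6 * n - 31) :=
    mul_nonneg (by linarith) (by linarith)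
  have e4 : (L : ℝ) ≤ a * L := le_mul_of_one_le_left (by positivity) ha'
  linarith

theorem exists_nat_mem_half_interval {a b : ℕ} {T : ℝ} (ha : 0 < a) (hb : 0 < b) (hT : 0 ≤ T) :
    ∃ m : ℕ, m + 1 ≤ a + b ∧ 2 * (m : ℝ) ≤ 2 + T / 4 ∧ min ((a : ℝ) + b) T / 16 ≤ m := by
  set M := min ((a : ℝ) + b) T
  have hM : 0 ≤ M := le_min (by positivity) hT
  have hfl := Nat.floor_le (show 0 ≤ M / 8 by positivity)
  have hlt := Nat.lt_floor_add_one (M / 8)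
  have hMa : M ≤ (a : ℝ) + b := min_le_left _ _
  have hMT : M ≤ T := min_le_right _ _
  have ha' : (1 : ℝ) ≤ a := by exact_mod_cast ha
  have hb' : (1 : ℝ) ≤ b := by exact_mod_cast hb
  rcases Nat.eq_zero_or_pos ⌊M / 8⌋₊ with h | h
  · rw [h] at hlt
    push_cast at hlt
    exact ⟨1, by omega, by push_cast; linarith, by push_cast; linarith⟩
  · refine ⟨⌊M / 8⌋₊, ?_, by linarith, ?_⟩
    · have : ((⌊M / 8⌋₊ + 1 : ℕ) : ℝ) ≤ ((a + b : ℕ) : ℝ) := by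
        push_cast
        linarith
      exact_mod_cast this
    · have : (1 : ℝ) ≤ (⌊M / 8⌋₊ : ℝ) := by exact_mod_cast h
      linarith

theorem le_elog2_coveringNumber_RclassQ {p : ℝ≥0∞} {d W L a b : ℕ} {ε : ℝ} (hp : 1 ≤ p)
    (hd : 0 < d) (hdW : d ≤ W) (ha : 0 < a) (hb : 0 < b) (hW : 2000 ≤ W) (hL : 2000 ≤ L)
    (hε : 0 < ε) (hε' : ε < 1 / 100) :
    ENNReal.ofReal (1 / 460800 * ((W : ℝ) ^ 2 * L) *
        min ((a : ℝ) + b) (Real.logb 2 (((W : ℝ) + 1) ^ L * (2 : ℝ) ^ (a * L) / ε))) ≤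
      elog2 (coveringNumber (ENNReal.ofReal ε) (RclassQ d W L a b) (cubeDist d p)) := by
  set T := Real.logb 2 (((W : ℝ) + 1) ^ L * (2 : ℝ) ^ (a * L) / ε) with hT
  have hT0 : 0 ≤ T := by
    have h1 : (1 : ℝ) ≤ ((W : ℝ) + 1) ^ L := one_le_pow₀ (by linarith [Nat.cast_nonneg (α := ℝ) W])
    have h2 : (1 : ℝ) ≤ (2 : ℝ) ^ (a * L) := one_le_pow₀ (by norm_num)
    refine Real.logb_nonneg (by norm_num) ?_
    rw [one_le_div hε]
    linarith [one_le_mul_of_one_le_of_one_le h1 h2]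
  obtain ⟨m, hmab, hmT, hmM⟩ := exists_nat_mem_half_interval ha hb hT0
  have hcov := natCast_pow_le_coveringNumber (k := W / 6) (n := L / 100) (L := L) hp hd hdW ha
    (by omega) (by omega) hmab (by omega) hε
    (two_mul_lt_separation ha (by omega) (by omega) hL (by omega) hε hε' hmT)
  refine le_trans (ENNReal.ofReal_le_ofReal ?_) (le_elog2_of_le (by positivity) hcov)
  have hk : (W : ℝ) / 12 ≤ (W / 6 : ℕ) := by
    have : W ≤ 12 * (W / 6) := by omega
    have : (W : ℝ) ≤ 12 * (W / 6 : ℕ) := by exact_mod_cast this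
    linarith
  have hn : (L : ℝ) / 200 ≤ (L / 100 : ℕ) := by
    have : L ≤ 200 * (L / 100) := by omega
    have : (L : ℝ) ≤ 200 * (L / 100 : ℕ) := by exact_mod_cast this
    linarith
  have hM : 0 ≤ min ((a : ℝ) + b) T := le_min (by positivity) hT0
  rw [← pow_mul, Nat.cast_pow, Real.logb_pow, Nat.cast_ofNat, Real.logb_self_eq_one (by norm_num),
    mul_one]
  simp only [Nat.cast_mul]
  calc 1 / 460800 * ((W : ℝ) ^ 2 * L) * min ((a : ℝ) + b) T
      = min ((a : ℝ) + b) T / 16 * ((L : ℝ) / 200 * ((W : ℝ) / 12 * ((W : ℝ) / 12))) := by ring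
    _ ≤ _ := by gcongr

/-- Covering number upper and lower bounds for fully-connected ReLU
networks with base-2 quantized weights. -/
theorem covering_bounds_quantized_networks :
    (∃ C : ℝ, 0 < C ∧
      ∀ (p : ℝ≥0∞) (d W L a b : ℕ) (ε : ℝ),
        1 ≤ p → 0 < d → 0 < L → d ≤ W → 0 < a → 0 < b →
        0 < ε → ε < 1 / 2 →
        elog2 (coveringNumber (ENNReal.ofReal ε) (RclassQ d W L a b) (cubeDist d p))
          ≤ ENNReal.ofReal
              (C * ((W : ℝ) ^ 2 * L) *
                min ((a : ℝ) + b)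
                  (Real.logb 2 (((W : ℝ) + 1) ^ L * (2 : ℝ) ^ (a * L) / ε))))
    ∧ (∃ c D E : ℝ, 0 < c ∧ 0 < D ∧ 0 < E ∧
      ∀ (p : ℝ≥0∞) (d W L a b : ℕ) (ε : ℝ),
        1 ≤ p → 0 < d → d ≤ W → 0 < a → 0 < b →
        D ≤ (W : ℝ) → D ≤ (L : ℝ) →
        E * Real.logb 2 (W : ℝ) ≤ (L : ℝ) * ((a : ℝ) + b) →
        0 < ε → ε < 1 / 100 →
        ENNReal.ofReal
            (c * ((W : ℝ) ^ 2 * L) *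
              min ((a : ℝ) + b)
                (Real.logb 2 (((W : ℝ) + 1) ^ L * (2 : ℝ) ^ (a * L) / ε)))
          ≤ elog2 (coveringNumber (ENNReal.ofReal ε) (RclassQ d W L a b) (cubeDist d p))) := by
  refine ⟨⟨13, by norm_num, fun p d W L a b ε _ hd hL hdW _ hb hε hε' =>
      elog2_coveringNumber_RclassQ_le p hd hL hdW hb hε hε'⟩,
    1 / 460800, 2000, 1, by norm_num, by norm_num, by norm_num,
    fun p d W L a b ε hp hd hdW ha hb hW hL _ hε hε' => ?_⟩
  exact le_elog2_coveringNumber_RclassQ hp hd hdW ha hb (by exact_mod_cast hW)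
    (by exact_mod_cast hL) hε hε'
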